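/- Let M_p be a weight sequence satisfying (M.1), (M.2) and (M.3), let W ⊆ ℝ^d be an unbounded set, and let ω : W → (0,∞) be an arbitrary positive function. A Beurling ultradistribution f of class (M_p) on ℝ^d satisfies sup_{h∈W} |⟨f, φ(·−h)⟩|/ω(h) < ∞ for every φ ∈ D^{(M_p)}(ℝ^d) if and only if for every R > 0 there exist continuous functions f_α : W_R → ℂ (α ∈ ℕ^d), where W_R := W + B(0,R), and some ℓ > 0, C > 0 with |f_α(x+h)| ≤ C (ℓ^{|α|}/M_α) ω(x) for all x ∈ W, |h| < R and α ∈ ℕ^d, such that ⟨f,φ⟩ = Σ_{α∈ℕ^d} (−1)^{|α|} ∫ f_α(x) ∂^αφ(x) dx (absolutely convergent) for every φ ∈ D^{(M_p)}(ℝ^d) with supp φ ⊂ W_R. -/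

import Mathlib

open MeasureTheory Real
open scoped BigOperators Pointwise

noncomputable section

/-- `ℝ^d` with the Euclidean norm. -/
abbrev Rd (d : ℕ) := EuclideanSpace ℝ (Fin d)

/-- Condition (M.1): a positive, logarithmically convex weight sequence. -/
def IsM1 (M : ℕ → ℝ) : Prop :=
  (∀ p, 0 < M p) ∧ ∀ p : ℕ, 1 ≤ p → (M p) ^ 2 ≤ M (p - 1) * M (p + 1)

/-- Condition (M.2)'. -/
def IsM2' (M : ℕ → ℝ) : Prop :=
  ∃ A H : ℝ, 1 ≤ A ∧ 1 ≤ H ∧ ∀ p : ℕ, M (p + 1) ≤ A * H ^ p * M p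

/-- Condition (M.2). -/
def IsM2 (M : ℕ → ℝ) : Prop :=
  ∃ A H : ℝ, 1 ≤ A ∧ 1 ≤ H ∧ ∀ p q : ℕ, M (p + q) ≤ A * H ^ (p + q) * M p * M q

/-- Condition (M.3)'. -/
def IsM3' (M : ℕ → ℝ) : Prop := Summable fun p : ℕ => M p / M (p + 1)

/-- Condition (M.3). -/
def IsM3 (M : ℕ → ℝ) : Prop :=
  IsM3' M ∧ ∃ c₀ > (0 : ℝ), ∀ q : ℕ, 1 ≤ q →
    (∑' j : ℕ, M (q + j - 1) / M (q + j)) ≤ c₀ * q * (M (q - 1) / M q)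

/-- The associated function `M(t) = sup_p log (t^p M 0 / M p)`, with `M(0) = 0`. -/
def assocFn (M : ℕ → ℝ) (t : ℝ) : ℝ :=
  if t = 0 then 0 else ⨆ p : ℕ, Real.log (t ^ p * M 0 / M p)

variable {d : ℕ}

/-- The partial derivative in the `i`-th coordinate direction. -/
def pder (i : Fin d) (f : Rd d → ℂ) : Rd d → ℂ :=
  fun x => fderiv ℝ f x (EuclideanSpace.single i 1)

/-- The multi-index partial derivative `∂^α`. -/
def mderiv (α : Fin d → ℕ) (f : Rd d → ℂ) : Rd d → ℂ :=
  (List.finRange d).foldr (fun i g => (pder i)^[α i] g) f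

/-- The order `|α|` of a multi-index. -/
def mOrd (α : Fin d → ℕ) : ℕ := ∑ i, α i

/-- The factorial `α!` of a multi-index. -/
def mFact (α : Fin d → ℕ) : ℕ := ∏ i, Nat.factorial (α i)

/-- The set of quotients defining the norm of `E^{M_p,ℓ}(K)`. -/
def ESet (M : ℕ → ℝ) (ℓ : ℝ) (K : Set (Rd d)) (φ : Rd d → ℂ) : Set ℝ :=
  {r | ∃ (α : Fin d → ℕ) (x : Rd d), x ∈ K ∧
    r = ‖mderiv α φ x‖ / (ℓ ^ mOrd α * M (mOrd α))}

/-- `‖φ‖_{E^{M_p,ℓ}(K)}`. -/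
def Enorm (M : ℕ → ℝ) (ℓ : ℝ) (K : Set (Rd d)) (φ : Rd d → ℂ) : ℝ :=
  sSup (ESet M ℓ K φ)

/-- Finiteness of `‖φ‖_{E^{M_p,ℓ}(K)}`. -/
def EnormFin (M : ℕ → ℝ) (ℓ : ℝ) (K : Set (Rd d)) (φ : Rd d → ℂ) : Prop :=
  BddAbove (ESet M ℓ K φ)

/-- Membership in the test space `D^{(M_p)}(ℝ^d)`. -/
def IsTestD (M : ℕ → ℝ) (φ : Rd d → ℂ) : Prop :=
  ContDiff ℝ (⊤ : ℕ∞) φ ∧ HasCompactSupport φ ∧ ∀ ℓ > (0 : ℝ), EnormFin M ℓ (tsupport φ) φ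

/-- `f` is a Beurling ultradistribution of class `(M_p)`. -/
def IsUltraD (M : ℕ → ℝ) (f : (Rd d → ℂ) →ₗ[ℂ] ℂ) : Prop :=
  ∀ K : Set (Rd d), IsCompact K → ∃ ℓ > (0 : ℝ), ∃ C > (0 : ℝ), ∀ φ : Rd d → ℂ,
    IsTestD M φ → tsupport φ ⊆ K → ‖f φ‖ ≤ C * Enorm M ℓ K φ

/-- Euclidean dot product. -/
def dotR (ξ t : Rd d) : ℝ := ∑ i, ξ i * t i

/-- The window `t ↦ conj(ψ(t-x)) e^{-2πi ξ·t}` of the short-time Fourier transform. -/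
def windowFn (ψ : Rd d → ℂ) (x ξ : Rd d) : Rd d → ℂ :=
  fun t => (starRingEnd ℂ) (ψ (t - x)) * Complex.exp (-(2 * Real.pi * dotR ξ t : ℝ) * Complex.I)

/-- The short-time Fourier transform of a function `φ` with respect to the window `ψ`. -/
def STFTf (ψ φ : Rd d → ℂ) (x ξ : Rd d) : ℂ := ∫ t, φ t * windowFn ψ x ξ t

/-- The short-time Fourier transform of a linear functional `f` w.r.t. the window `ψ`. -/
def STFTd (f : (Rd d → ℂ) →ₗ[ℂ] ℂ) (ψ : Rd d → ℂ) (x ξ : Rd d) : ℂ := f (windowFn ψ x ξ)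

/-- The weight condition (5): `ω(·+x)/ω(x)` locally uniformly bounded. -/
def OmegaCond (ω : Rd d → ℝ) : Prop :=
  (∀ x, 0 < ω x) ∧ Measurable ω ∧
    ∀ R > (0 : ℝ), ∃ C > (0 : ℝ), ∀ x h : Rd d, ‖h‖ ≤ R → ω (x + h) ≤ C * ω x

/-! ### Calculus of the multi-index derivatives -/

/-- The real-linear form with prescribed values on the coordinate directions. -/
def jetD (c : Fin d → ℂ) : Rd d →L[ℝ] ℂ :=
  ∑ i, (EuclideanSpace.proj i : Rd d →L[ℝ] ℝ).smulRight (c i)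

lemma jetD_apply (c : Fin d → ℂ) (v : Rd d) : jetD c v = ∑ i, (v i : ℂ) * c i := by
  simp [jetD]

lemma jetD_single (c : Fin d → ℂ) (i : Fin d) : jetD c (EuclideanSpace.single i 1) = c i := by
  rw [jetD_apply, Finset.sum_eq_single i] <;> simp +contextual

lemma norm_jetD_le (c : Fin d → ℂ) : ‖jetD c‖ ≤ ∑ i, ‖c i‖ := by
  refine ContinuousLinearMap.opNorm_le_bound _ (by positivity) fun v => ?_
  rw [jetD_apply, Finset.sum_mul]
  refine (norm_sum_le _ _).trans (Finset.sum_le_sum fun i _ => ?_)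
  rw [norm_mul, mul_comm]
  gcongr
  simpa using PiLp.norm_apply_le v i

lemma fderiv_eq_jetD (f : Rd d → ℂ) (x : Rd d) : fderiv ℝ f x = jetD fun i => pder i f x := by
  refine ContinuousLinearMap.coe_injective
    ((EuclideanSpace.basisFun (Fin d) ℝ).toBasis.ext fun i => ?_)
  simp [jetD_single, pder]

lemma contDiff_jetD {n : WithTop ℕ∞} {c : Fin d → Rd d → ℂ} (h : ∀ i, ContDiff ℝ n (c i)) :
    ContDiff ℝ n fun x => jetD fun i => c i x := by
  unfold jetD
  exact ContDiff.sum fun i _ => contDiff_const.smulRight (h i)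

lemma contDiff_pder {f : Rd d → ℂ} (hf : ContDiff ℝ (⊤ : ℕ∞) f) (i : Fin d) :
    ContDiff ℝ (⊤ : ℕ∞) (pder i f) := by
  unfold pder
  exact (hf.fderiv_right (m := (⊤ : ℕ∞)) (by simp)).clm_apply contDiff_const

lemma contDiff_pder_iterate {f : Rd d → ℂ} (hf : ContDiff ℝ (⊤ : ℕ∞) f) (i : Fin d) (k : ℕ) :
    ContDiff ℝ (⊤ : ℕ∞) ((pder i)^[k] f) := by
  induction k with
  | zero => exact hf
  | succ k ih => rw [Function.iterate_succ_apply']; exact contDiff_pder ih i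

lemma pder_comm {f : Rd d → ℂ} (hf : ContDiff ℝ (⊤ : ℕ∞) f) (i j : Fin d) :
    pder i (pder j f) = pder j (pder i f) := by
  funext x
  have hs : IsSymmSndFDerivAt ℝ f x := hf.contDiffAt.isSymmSndFDerivAt (by
    rw [minSmoothness_of_isRCLikeNormedField]; norm_cast)
  have hd : DifferentiableAt ℝ (fderiv ℝ f) x :=
    ((hf.fderiv_right (m := 1) (by norm_cast)).differentiable (by simp)).differentiableAt
  have key : ∀ k l : Fin d, pder k (pder l f) x =
      fderiv ℝ (fderiv ℝ f) x (EuclideanSpace.single k 1) (EuclideanSpace.single l 1) := by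
    intro k l
    have : pder l f = fun y => fderiv ℝ f y (EuclideanSpace.single l 1) := rfl
    rw [this]
    unfold pder
    rw [fderiv_clm_apply hd (by fun_prop)]
    simp
  rw [key, key]
  exact hs.eq _ _

lemma pder_iterate_comm {f : Rd d → ℂ} (hf : ContDiff ℝ (⊤ : ℕ∞) f) (i j : Fin d) (k : ℕ) :
    pder i ((pder j)^[k] f) = (pder j)^[k] (pder i f) := by
  induction k with
  | zero => rfl
  | succ k ih =>
    rw [Function.iterate_succ_apply', Function.iterate_succ_apply',
      pder_comm (contDiff_pder_iterate hf j k), ih]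

lemma contDiff_foldr {f : Rd d → ℂ} (hf : ContDiff ℝ (⊤ : ℕ∞) f) (α : Fin d → ℕ)
    (l : List (Fin d)) :
    ContDiff ℝ (⊤ : ℕ∞) (l.foldr (fun i g => (pder i)^[α i] g) f) := by
  induction l with
  | nil => exact hf
  | cons a l ih => exact contDiff_pder_iterate ih a _

lemma foldr_add_single {f : Rd d → ℂ} (hf : ContDiff ℝ (⊤ : ℕ∞) f) (α : Fin d → ℕ)
    (i : Fin d) (l : List (Fin d)) (hl : l.Nodup) :
    l.foldr (fun j g => (pder j)^[(α + Pi.single i 1 : Fin d → ℕ) j] g) f =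
      if i ∈ l then pder i (l.foldr (fun j g => (pder j)^[α j] g) f)
      else l.foldr (fun j g => (pder j)^[α j] g) f := by
  induction l with
  | nil => simp
  | cons a l ih =>
    rw [List.nodup_cons] at hl
    have hs := contDiff_foldr hf α l
    simp only [List.foldr_cons]
    rw [ih hl.2]
    by_cases hai : i = a
    · subst hai
      simp [hl.1, Function.iterate_add_apply, pder_iterate_comm hs]
    · by_cases hil : i ∈ l
      · simp [hai, hil, pder_iterate_comm hs]
      · simp [hai, hil]

lemma contDiff_mderiv {f : Rd d → ℂ} (hf : ContDiff ℝ (⊤ : ℕ∞) f) (α : Fin d → ℕ) :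
    ContDiff ℝ (⊤ : ℕ∞) (mderiv α f) :=
  contDiff_foldr hf α _

lemma mderiv_zero (f : Rd d → ℂ) : mderiv 0 f = f := by
  simp [mderiv]

lemma mderiv_add_single {f : Rd d → ℂ} (hf : ContDiff ℝ (⊤ : ℕ∞) f) (α : Fin d → ℕ) (i : Fin d) :
    mderiv (α + Pi.single i 1) f = pder i (mderiv α f) := by
  unfold mderiv
  rw [foldr_add_single hf α i _ (List.nodup_finRange d), if_pos (List.mem_finRange i)]

lemma multiIndex_induction {P : (Fin d → ℕ) → Prop} (h0 : P 0)
    (hs : ∀ α i, P α → P (α + Pi.single i 1)) (α : Fin d → ℕ) : P α := by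
  suffices ∀ (n : ℕ) (β : Fin d → ℕ), mOrd β = n → P β from this _ α rfl
  intro n
  induction n with
  | zero =>
    intro β hβ
    have : β = 0 := by
      funext i
      exact (Finset.sum_eq_zero_iff.1 hβ) i (Finset.mem_univ i)
    rwa [this]
  | succ n ih =>
    intro β hβ
    obtain ⟨i, hi⟩ : ∃ i, β i ≠ 0 := by
      by_contra! h
      simp [mOrd, h] at hβ
    have hle : Pi.single i 1 ≤ β := by
      intro j
      by_cases hj : j = i
      · subst hj; simp; omega
      · simp [Pi.single_eq_of_ne hj]
    have hb : β = (β - Pi.single i 1) + Pi.single i 1 := (tsub_add_cancel_of_le hle).symm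
    rw [hb]
    refine hs _ _ (ih _ ?_)
    rw [hb] at hβ
    simpa [mOrd, Finset.sum_add_distrib] using hβ

lemma mOrd_add (α β : Fin d → ℕ) : mOrd (α + β) = mOrd α + mOrd β := by
  simp [mOrd, Finset.sum_add_distrib]

@[simp] lemma mOrd_single (i : Fin d) (k : ℕ) : mOrd (Pi.single i k) = k := by
  simp [mOrd]

@[simp] lemma mOrd_zero : mOrd (0 : Fin d → ℕ) = 0 := by
  simp [mOrd]

lemma mderiv_add {f : Rd d → ℂ} (hf : ContDiff ℝ (⊤ : ℕ∞) f) (α β : Fin d → ℕ) :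
    mderiv (α + β) f = mderiv α (mderiv β f) := by
  induction α using multiIndex_induction with
  | h0 => rw [zero_add, mderiv_zero]
  | hs α i ih =>
    rw [add_right_comm, mderiv_add_single hf, ih, mderiv_add_single (contDiff_mderiv hf β)]

lemma mderiv_single {f : Rd d → ℂ} (hf : ContDiff ℝ (⊤ : ℕ∞) f) (i : Fin d) (k : ℕ) :
    mderiv (Pi.single i k) f = (pder i)^[k] f := by
  induction k with
  | zero => simp [mderiv_zero]
  | succ k ih =>
    rw [Function.iterate_succ_apply', ← ih, ← mderiv_add_single hf, Pi.single_add]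

lemma hasFDerivAt_mderiv {f : Rd d → ℂ} (hf : ContDiff ℝ (⊤ : ℕ∞) f) (α : Fin d → ℕ) (x : Rd d) :
    HasFDerivAt (mderiv α f) (jetD fun i => mderiv (α + Pi.single i 1) f x) x := by
  simp_rw [mderiv_add_single hf, ← fderiv_eq_jetD]
  exact ((contDiff_mderiv hf α).differentiable (by simp)).differentiableAt.hasFDerivAt

/-- A family of functions each of which has the next ones as partial derivatives is the jet of
its `0`-th member. -/
lemma jet_criterion {F : (Fin d → ℕ) → Rd d → ℂ}
    (hF : ∀ α x, HasFDerivAt (F α) (jetD fun i => F (α + Pi.single i 1) x) x) :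
    ContDiff ℝ (⊤ : ℕ∞) (F 0) ∧ ∀ α, mderiv α (F 0) = F α := by
  have hcd : ∀ (n : ℕ) (α : Fin d → ℕ), ContDiff ℝ n (F α) := by
    intro n
    induction n with
    | zero =>
      intro α
      exact contDiff_zero.2 (continuous_iff_continuousAt.2 fun x => (hF α x).continuousAt)
    | succ n ih =>
      intro α
      have : ((n + 1 : ℕ) : WithTop ℕ∞) = (n : WithTop ℕ∞) + 1 := by norm_cast
      rw [this, contDiff_succ_iff_fderiv]
      refine ⟨fun x => (hF α x).differentiableAt, by simp, ?_⟩
      have he : fderiv ℝ (F α) = fun x => jetD fun i => F (α + Pi.single i 1) x :=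
        funext fun x => (hF α x).fderiv
      rw [he]
      exact contDiff_jetD fun i => ih _
  have h0 : ContDiff ℝ (⊤ : ℕ∞) (F 0) := contDiff_infty.2 fun n => hcd n 0
  refine ⟨h0, fun α => ?_⟩
  induction α using multiIndex_induction with
  | h0 => exact mderiv_zero _
  | hs α i ih =>
    rw [mderiv_add_single h0, ih]
    funext x
    rw [pder, (hF α x).fderiv, jetD_single]

lemma mderiv_translate {f : Rd d → ℂ} (hf : ContDiff ℝ (⊤ : ℕ∞) f) (h : Rd d) (α : Fin d → ℕ) :
    mderiv α (fun x => f (x - h)) = fun x => mderiv α f (x - h) := by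
  have := (jet_criterion (F := fun α x => mderiv α f (x - h)) fun α x =>
    by
      simpa using! (hasFDerivAt_mderiv hf α (x - h)).comp x ((hasFDerivAt_id x).sub_const h)).2 α
  simpa [mderiv_zero] using this

lemma contDiff_translate {f : Rd d → ℂ} (hf : ContDiff ℝ (⊤ : ℕ∞) f) (h : Rd d) :
    ContDiff ℝ (⊤ : ℕ∞) fun x => f (x - h) :=
  hf.comp (contDiff_id.sub contDiff_const)

lemma mderiv_fun_add {f g : Rd d → ℂ} (hf : ContDiff ℝ (⊤ : ℕ∞) f) (hg : ContDiff ℝ (⊤ : ℕ∞) g)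
    (α : Fin d → ℕ) : mderiv α (f + g) = mderiv α f + mderiv α g := by
  have := (jet_criterion (F := fun α => mderiv α f + mderiv α g) fun α x => by
    have h := (hasFDerivAt_mderiv hf α x).add (hasFDerivAt_mderiv hg α x)
    refine h.congr_fderiv ?_
    ext v
    simp [jetD_apply, mul_add, Finset.sum_add_distrib]).2 α
  simpa [mderiv_zero] using this

lemma mderiv_const_smul {f : Rd d → ℂ} (hf : ContDiff ℝ (⊤ : ℕ∞) f) (c : ℂ)
    (α : Fin d → ℕ) : mderiv α (c • f) = c • mderiv α f := by
  have := (jet_criterion (F := fun α => c • mderiv α f) fun α x => by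
    have h := (hasFDerivAt_mderiv hf α x).const_smul c
    refine h.congr_fderiv ?_
    ext v
    simp only [jetD_apply, smul_apply, smul_eq_mul, Finset.mul_sum,
      Pi.smul_apply]
    exact Finset.sum_congr rfl fun i _ => by ring).2 α
  simpa [mderiv_zero] using this

lemma mderiv_sum {ι : Type*} {s : Finset ι} {f : ι → Rd d → ℂ}
    (hf : ∀ j, ContDiff ℝ (⊤ : ℕ∞) (f j)) (α : Fin d → ℕ) :
    mderiv α (∑ j ∈ s, f j) = ∑ j ∈ s, mderiv α (f j) := by
  classical
  induction s using Finset.induction_on with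
  | empty =>
    simpa using mderiv_const_smul (f := (0 : Rd d → ℂ)) contDiff_const 0 α
  | insert a s ha ih =>
    rw [Finset.sum_insert ha, Finset.sum_insert ha, mderiv_fun_add (hf a), ih]
    have := ContDiff.sum (s := s) (𝕜 := ℝ) (n := ((⊤ : ℕ∞) : WithTop ℕ∞)) fun j _ => hf j
    convert this using 1
    funext x
    simp

lemma tsupport_pder_subset (f : Rd d → ℂ) (i : Fin d) : tsupport (pder i f) ⊆ tsupport f :=
  tsupport_fderiv_apply_subset ℝ _

lemma tsupport_mderiv_subset {f : Rd d → ℂ} (hf : ContDiff ℝ (⊤ : ℕ∞) f) (α : Fin d → ℕ) :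
    tsupport (mderiv α f) ⊆ tsupport f := by
  induction α using multiIndex_induction with
  | h0 => rw [mderiv_zero]
  | hs α i ih =>
    rw [mderiv_add_single hf]
    exact (tsupport_pder_subset _ i).trans ih

lemma hasCompactSupport_mderiv {f : Rd d → ℂ} (hf : ContDiff ℝ (⊤ : ℕ∞) f)
    (hc : HasCompactSupport f) (α : Fin d → ℕ) : HasCompactSupport (mderiv α f) :=
  hc.of_isClosed_subset (isClosed_tsupport _) (tsupport_mderiv_subset hf α)

lemma tsupport_translate (f : Rd d → ℂ) (h : Rd d) :
    tsupport (fun x => f (x - h)) = (fun x => x - h) ⁻¹' tsupport f :=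
  tsupport_comp_eq_preimage f (Homeomorph.subRight h)

lemma norm_sub_le_of_norm_pder_le {f : Rd d → ℂ} (hf : ContDiff ℝ (⊤ : ℕ∞) f) {B : ℝ}
    (hB : ∀ i x, ‖pder i f x‖ ≤ B) (x y : Rd d) : ‖f x - f y‖ ≤ d * B * ‖x - y‖ := by
  refine Convex.norm_image_sub_le_of_norm_fderiv_le (𝕜 := ℝ) (s := Set.univ)
    (fun z _ => (hf.differentiable (by simp)).differentiableAt) (fun z _ => ?_) convex_univ
    (Set.mem_univ y) (Set.mem_univ x)
  rw [fderiv_eq_jetD]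
  refine (norm_jetD_le _).trans ((Finset.sum_le_sum fun i _ => hB i z).trans ?_)
  simp

/-! ### Weight sequences -/

lemma summable_pi_prod {β : Type*} {f : β → ℝ} (h0 : ∀ b, 0 ≤ f b) (hf : Summable f) :
    Summable fun n : Fin d → β => ∏ j, f (n j) := by
  classical
  refine summable_of_sum_le (c := ∏ _j : Fin d, ∑' b, f b)
    (fun n => Finset.prod_nonneg fun j _ => h0 _) fun u => ?_
  have hsub : u ⊆ Fintype.piFinset fun j => u.image fun n => n j := by
    intro n hn
    rw [Fintype.mem_piFinset]
    exact fun j => Finset.mem_image_of_mem _ hn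
  refine (Finset.sum_le_sum_of_subset_of_nonneg hsub
    fun n _ _ => Finset.prod_nonneg fun j _ => h0 _).trans ?_
  rw [← Finset.prod_univ_sum (fun j => u.image fun n => n j) fun _ b => f b]
  exact Finset.prod_le_prod (fun j _ => Finset.sum_nonneg fun b _ => h0 b)
    fun j _ => hf.sum_le_tsum _ fun b _ => h0 b

lemma prod_le_const_mul_pow {u : ℕ → ℝ} (h0 : ∀ k, 0 ≤ u k)
    (hu : Filter.Tendsto u Filter.atTop (nhds 0)) {h : ℝ} (hh : 0 < h) :
    ∃ C > 0, ∀ p, ∏ k ∈ Finset.range p, u k ≤ C * h ^ p := by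
  obtain ⟨N, hN⟩ := Filter.eventually_atTop.1 (hu.eventually_lt_const hh)
  have hnn : ∀ q, 0 ≤ ∏ k ∈ Finset.range q, (u k / h) := fun q =>
    Finset.prod_nonneg fun k _ => by have := h0 k; positivity
  have hS : 0 ≤ ∑ q ∈ Finset.range (N + 1), ∏ k ∈ Finset.range q, (u k / h) :=
    Finset.sum_nonneg fun q _ => hnn q
  refine ⟨1 + ∑ q ∈ Finset.range (N + 1), ∏ k ∈ Finset.range q, (u k / h), by positivity,
    fun p => ?_⟩
  have h1 : ∀ p, ∏ k ∈ Finset.range p, (u k / h) ≤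
      1 + ∑ q ∈ Finset.range (N + 1), ∏ k ∈ Finset.range q, (u k / h) := by
    intro p
    induction p with
    | zero => simpa using hS
    | succ p ih =>
      by_cases hp : p + 1 ≤ N
      · have := Finset.single_le_sum (f := fun q => ∏ k ∈ Finset.range q, (u k / h))
          (s := Finset.range (N + 1)) (fun q _ => hnn q) (Finset.mem_range.2 (Nat.lt_succ_of_le hp))
        linarith
      · rw [Finset.prod_range_succ]
        refine (mul_le_of_le_one_right (hnn p) ?_).trans ih
        rw [div_le_one hh]
        exact (hN p (by omega)).le
  have h2 := h1 p
  rw [Finset.prod_div_distrib, Finset.prod_const, Finset.card_range,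
    div_le_iff₀ (by positivity)] at h2
  exact h2

section Weight

variable {M : ℕ → ℝ}

lemma IsM1.ratio_mono (hM : IsM1 M) : Monotone fun p => M (p + 1) / M p := by
  refine monotone_nat_of_le_succ fun p => ?_
  have := hM.2 (p + 1) (by omega)
  rw [div_le_div_iff₀ (hM.1 _) (hM.1 _)]
  simp only [Nat.add_sub_cancel] at this
  nlinarith

lemma IsM1.mul_le (hM : IsM1 M) (p q : ℕ) : M p * M q ≤ M 0 * M (p + q) := by
  induction q with
  | zero => rw [mul_comm, add_zero]
  | succ q ih =>
    have h1 : M (q + 1) / M q ≤ M (p + q + 1) / M (p + q) := hM.ratio_mono (by omega)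
    have h2 := mul_le_mul ih h1 (div_pos (hM.1 _) (hM.1 _)).le (mul_pos (hM.1 _) (hM.1 _)).le
    have hq := (hM.1 q).ne'
    have hpq := (hM.1 (p + q)).ne'
    calc M p * M (q + 1) = M p * M q * (M (q + 1) / M q) := by field_simp
      _ ≤ _ := h2
      _ = _ := by field_simp; rfl

lemma IsM1.prod_le (hM : IsM1 M) : ∃ C > 0, ∀ s : Fin d → ℕ, ∏ j, M (s j) ≤ C * M (mOrd s) := by
  suffices ∀ S : Finset (Fin d), ∃ C > 0, ∀ s : Fin d → ℕ,
      ∏ j ∈ S, M (s j) ≤ C * M (∑ j ∈ S, s j) from this Finset.univ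
  intro S
  induction S using Finset.induction_on with
  | empty =>
    refine ⟨1 / M 0, by have := hM.1 0; positivity, fun s => ?_⟩
    have := (hM.1 0).ne'
    simp [this]
  | insert a S ha ih =>
    obtain ⟨C, hC, h⟩ := ih
    refine ⟨C * M 0, mul_pos hC (hM.1 0), fun s => ?_⟩
    rw [Finset.prod_insert ha, Finset.sum_insert ha]
    calc M (s a) * ∏ j ∈ S, M (s j) ≤ M (s a) * (C * M (∑ j ∈ S, s j)) :=
          mul_le_mul_of_nonneg_left (h s) (hM.1 _).le
      _ = C * (M (s a) * M (∑ j ∈ S, s j)) := by ring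
      _ ≤ C * (M 0 * M (s a + ∑ j ∈ S, s j)) := mul_le_mul_of_nonneg_left (hM.mul_le _ _) hC.le
      _ = _ := by ring

lemma IsM2.le_prod (hM1 : IsM1 M) (hM : IsM2 M) : ∃ C > 0, ∃ H ≥ 1, ∀ s : Fin d → ℕ,
    M (mOrd s) ≤ C * H ^ mOrd s * ∏ j, M (s j) := by
  obtain ⟨A, H, hA, hH, hAH⟩ := hM
  suffices ∀ S : Finset (Fin d), ∃ C > 0, ∃ H ≥ 1, ∀ s : Fin d → ℕ,
      M (∑ j ∈ S, s j) ≤ C * H ^ (∑ j ∈ S, s j) * ∏ j ∈ S, M (s j) from this Finset.univ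
  intro S
  induction S using Finset.induction_on with
  | empty => exact ⟨M 0, hM1.1 0, 1, le_rfl, fun s => by simp⟩
  | insert a S ha ih =>
    obtain ⟨C, hC, H', hH', h⟩ := ih
    refine ⟨A * C, by positivity, H * H', by nlinarith, fun s => ?_⟩
    rw [Finset.prod_insert ha, Finset.sum_insert ha]
    set σ := ∑ j ∈ S, s j
    have hMa := hM1.1 (s a)
    have hP : 0 < ∏ j ∈ S, M (s j) := Finset.prod_pos fun j _ => hM1.1 _
    calc M (s a + σ) ≤ A * H ^ (s a + σ) * M (s a) * M σ := hAH _ _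
      _ ≤ A * H ^ (s a + σ) * M (s a) * (C * H' ^ σ * ∏ j ∈ S, M (s j)) := by
        gcongr; exact h s
      _ ≤ A * H ^ (s a + σ) * M (s a) * (C * H' ^ (s a + σ) * ∏ j ∈ S, M (s j)) := by
        gcongr
        omega
      _ = _ := by ring

lemma IsM3'.tendsto (hM : IsM3' M) :
    Filter.Tendsto (fun p => M p / M (p + 1)) Filter.atTop (nhds 0) :=
  hM.tendsto_atTop_zero

lemma pow_le_const_mul (hM1 : IsM1 M) (hM3 : IsM3' M) {B : ℝ} (hB : 0 < B) :
    ∃ C > 0, ∀ p, B ^ p ≤ C * M p := by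
  obtain ⟨C, hC, h⟩ := prod_le_const_mul_pow
    (fun k => (div_pos (hM1.1 k) (hM1.1 (k + 1))).le) hM3.tendsto (inv_pos.2 hB)
  refine ⟨C / M 0, div_pos hC (hM1.1 0), fun p => ?_⟩
  have h1 : ∏ k ∈ Finset.range p, (M k / M (k + 1)) = M 0 / M p :=
    Finset.prod_range_induction _ (fun p => M 0 / M p) (div_self (hM1.1 0).ne') p (fun k _ => by
      have := (hM1.1 k).ne'
      have := (hM1.1 (k + 1)).ne'
      field_simp)
  have h2 := h p
  rw [h1, div_le_iff₀ (hM1.1 p)] at h2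
  rw [div_mul_eq_mul_div, le_div_iff₀ (hM1.1 0)]
  calc B ^ p * M 0 ≤ B ^ p * (C * B⁻¹ ^ p * M p) := by gcongr
    _ = _ := by rw [inv_pow]; field_simp

/-- The supremum of `ρ ^ s / M s` over `s` is attained up to a factor. -/
lemma exists_almost_max (hM1 : IsM1 M) (hM3 : IsM3' M) {ρ : ℝ} (hρ : 0 ≤ ρ) :
    ∃ r : ℕ, (ρ = 0 → r = 0) ∧ ∀ s, ρ ^ s / M s ≤ 2 * (ρ ^ r / M r) := by
  rcases hρ.eq_or_lt with rfl | hρ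
  · refine ⟨0, fun _ => rfl, fun s => ?_⟩
    have := hM1.1 0
    rcases s with _ | s
    · have : 0 < 1 / M 0 := by positivity
      simp only [pow_zero]; linarith
    · simp; positivity
  · obtain ⟨C, hC, h⟩ := pow_le_const_mul hM1 hM3 hρ
    have hb : BddAbove (Set.range fun s => ρ ^ s / M s) := by
      refine ⟨C, ?_⟩
      rintro _ ⟨s, rfl⟩
      rw [div_le_iff₀ (hM1.1 s)]
      exact h s
    have hpos : 0 < ⨆ s, ρ ^ s / M s :=
      (div_pos (pow_pos hρ 0) (hM1.1 0)).trans_le (le_ciSup hb 0)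
    obtain ⟨r, hr⟩ := exists_lt_of_lt_ciSup (half_lt_self hpos)
    refine ⟨r, fun h => absurd h hρ.ne', fun s => ?_⟩
    have := le_ciSup hb s
    linarith

/-- The summable weight on the lattice of frequencies. -/
def latW (n : Fin d → ℤ) : ℝ := ∏ j, (1 + (n j : ℝ) ^ 2)⁻¹

lemma latW_pos (n : Fin d → ℤ) : 0 < latW n := Finset.prod_pos fun j _ => by positivity

lemma summable_latW : Summable (latW : (Fin d → ℤ) → ℝ) := by
  refine summable_pi_prod (f := fun ν : ℤ => (1 + (ν : ℝ) ^ 2)⁻¹) (fun ν => by positivity) ?_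
  have h1 : Summable fun ν : ℤ => 1 / (ν : ℝ) ^ 2 := Real.summable_one_div_int_pow.2 (by norm_num)
  refine Summable.of_nonneg_of_le (fun ν => by positivity) (fun ν => ?_)
    (h1.add (hasSum_ite_eq (0 : ℤ) (1 : ℝ)).summable)
  by_cases hν : ν = 0
  · simp [hν]
  · have : (0 : ℝ) < (ν : ℝ) ^ 2 := by positivity
    simp only [hν, if_false, add_zero, one_div]
    gcongr
    linarith

lemma inv_pow_le_latW {n : Fin d → ℤ} {i : Fin d} (hi : ∀ j, |n j| ≤ |n i|) (h0 : n i ≠ 0) :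
    ((|n i| : ℤ) : ℝ)⁻¹ ^ (2 * d) ≤ 2 ^ d * latW n := by
  have hν : (1 : ℝ) ≤ ((|n i| : ℤ) : ℝ) := by exact_mod_cast Int.one_le_abs h0
  set ν : ℝ := ((|n i| : ℤ) : ℝ)
  have : (2 : ℝ) ^ d * latW n = ∏ j, (2 * (1 + (n j : ℝ) ^ 2)⁻¹) := by
    rw [latW, Finset.prod_mul_distrib]; simp
  rw [this, pow_mul]
  have h2 : (ν⁻¹ ^ 2) ^ d = ∏ _j : Fin d, ν⁻¹ ^ 2 := by simp
  rw [h2]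
  refine Finset.prod_le_prod (fun j _ => by positivity) fun j _ => ?_
  have h3 : (n j : ℝ) ^ 2 ≤ ν ^ 2 := by
    rw [← sq_abs (n j : ℝ)]
    have : |(n j : ℝ)| ≤ ν := by
      have := hi j
      simp only [ν]
      exact_mod_cast this
    gcongr
  rw [inv_pow, ← div_eq_mul_inv, inv_eq_one_div, div_le_div_iff₀ (by positivity) (by positivity)]
  nlinarith

lemma exists_abs_max [Nonempty (Fin d)] (n : Fin d → ℤ) : ∃ i, ∀ j, |n j| ≤ |n i| := by
  obtain ⟨i, -, hi⟩ := Finset.exists_max_image Finset.univ (fun j => |n j|) Finset.univ_nonempty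
  exact ⟨i, fun j => hi j (Finset.mem_univ j)⟩

/-- Majorants of the growth of the exponentials, together with the direction and the order of the
derivative that is used to absorb them. -/
lemma exists_frequency_order [Nonempty (Fin d)] (hM1 : IsM1 M) (hM2 : IsM2 M) (hM3 : IsM3' M)
    {lam : ℝ} (hlam : 0 < lam) :
    ∃ E : ℤ → ℝ, (∀ ν, 0 < E ν) ∧ (∀ (ν : ℤ) (s : ℕ), (2 * π * |(ν : ℝ)| / lam) ^ s / M s ≤ E ν) ∧
      ∃ L > 0, ∃ C > 0, ∀ n : Fin d → ℤ, ∃ (i : Fin d) (p : ℕ), (n i ≠ 0 ∨ p = 0) ∧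
        (∏ j, E (n j)) / (2 * π * |(n i : ℝ)|) ^ p ≤ C * latW n * (L ^ p / M p) := by
  have hpi := Real.pi_pos
  choose r hr0 hr using fun ν : ℤ =>
    exists_almost_max hM1 hM3 (ρ := 2 * π * |(ν : ℝ)| / lam) (by positivity)
  have hpos : ∀ ν : ℤ, 0 < (2 * π * |(ν : ℝ)| / lam) ^ r ν / M (r ν) := by
    intro ν
    have := hM1.1 (r ν)
    by_cases hν : ν = 0
    · rw [hr0 ν (by simp [hν])]
      have := hM1.1 0
      simpa
    · have : 0 < |(ν : ℝ)| := by simpa using hν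
      positivity
  refine ⟨fun ν => 2 * ((2 * π * |(ν : ℝ)| / lam) ^ r ν / M (r ν)),
    fun ν => mul_pos two_pos (hpos ν), hr, ?_⟩
  obtain ⟨C₁, hC₁, H₁, hH₁, h₁⟩ := hM2.le_prod (d := d) hM1
  obtain ⟨A, H, hA, hH, hAH⟩ := hM2
  set K : ℝ := max 1 lam⁻¹
  have hK1 : 1 ≤ K := le_max_left _ _
  have hKl : lam⁻¹ ≤ K := le_max_right _ _
  set C₀ : ℝ := (∏ _j : Fin d, 2 * (1 / M 0)) * M 0 / latW (0 : Fin d → ℤ)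
  have hC₀ : 0 ≤ C₀ := by
    have h1 := hM1.1 0
    have h2 := latW_pos (0 : Fin d → ℤ)
    have : 0 ≤ ∏ _j : Fin d, 2 * (1 / M 0) := Finset.prod_nonneg fun j _ => by positivity
    positivity
  set C₂ : ℝ := 2 ^ d * A * M (2 * d) * C₁ * 2 ^ d
  have hC₂ : 0 < C₂ := by have := hM1.1 (2 * d); positivity
  refine ⟨K * H * H₁, by positivity, C₀ + C₂, by positivity, fun n => ?_⟩
  obtain ⟨i, hi⟩ := exists_abs_max n
  have hw := latW_pos n
  by_cases h0 : n i = 0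
  · refine ⟨i, 0, Or.inr rfl, ?_⟩
    have hn : n = 0 := by
      funext j
      have := hi j
      simpa [h0] using this
    subst hn
    have hM0 := hM1.1 0
    have : (∏ j : Fin d, 2 * ((2 * π * |(((0 : Fin d → ℤ) j : ℤ) : ℝ)| / lam) ^
        r ((0 : Fin d → ℤ) j) / M (r ((0 : Fin d → ℤ) j)))) = C₀ * latW (0 : Fin d → ℤ) * (1 / M 0) := by
      have h2 : r 0 = 0 := hr0 0 (by simp)
      simp only [Pi.zero_apply, h2, pow_zero, C₀]
      field_simp
    rw [this]
    simp only [pow_zero, div_one]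
    gcongr
    linarith
  · set P : ℕ := mOrd fun j => r (n j)
    refine ⟨i, P + 2 * d, Or.inl h0, ?_⟩
    set ν : ℝ := |(n i : ℝ)|
    have hν1 : 1 ≤ ν := by
      have := Int.one_le_abs h0
      simp only [ν]; exact_mod_cast this
    have hprodM : 0 < ∏ j, M (r (n j)) := Finset.prod_pos fun j _ => hM1.1 _
    have hE : (∏ j, 2 * ((2 * π * |(n j : ℝ)| / lam) ^ r (n j) / M (r (n j)))) ≤
        2 ^ d * ((2 * π * ν / lam) ^ P / ∏ j, M (r (n j))) := by
      rw [Finset.prod_mul_distrib, Finset.prod_div_distrib]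
      simp only [Finset.prod_const, Finset.card_univ, Fintype.card_fin]
      gcongr
      simp only [P, mOrd]
      rw [← Finset.prod_pow_eq_pow_sum]
      refine Finset.prod_le_prod (fun j _ => by positivity) fun j _ => ?_
      have : |(n j : ℝ)| ≤ ν := by simp only [ν]; exact_mod_cast hi j
      gcongr
    have hMp : M (P + 2 * d) ≤ A * H ^ (P + 2 * d) * M (2 * d) * C₁ * H₁ ^ (P + 2 * d) *
        ∏ j, M (r (n j)) := by
      have hM2d := hM1.1 (2 * d)
      calc M (P + 2 * d) ≤ A * H ^ (P + 2 * d) * M P * M (2 * d) := hAH _ _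
        _ ≤ A * H ^ (P + 2 * d) * (C₁ * H₁ ^ P * ∏ j, M (r (n j))) * M (2 * d) := by
          gcongr; exact h₁ _
        _ ≤ A * H ^ (P + 2 * d) * (C₁ * H₁ ^ (P + 2 * d) * ∏ j, M (r (n j))) * M (2 * d) := by
          gcongr
          omega
        _ = _ := by ring
    have hinv : (ν⁻¹) ^ (2 * d) ≤ 2 ^ d * latW n := by
      have := inv_pow_le_latW hi h0
      simpa [ν] using this
    have hpn : 0 < 2 * π * ν := by positivity
    have h2pi : (2 * π)⁻¹ ≤ 1 := inv_le_one_of_one_le₀ (by nlinarith [Real.pi_gt_three])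
    have hMP := hM1.1 (P + 2 * d)
    rw [div_le_iff₀ (by positivity)]
    refine hE.trans ?_
    have e1 : (2 * π * ν / lam) ^ P = lam⁻¹ ^ P * ((2 * π)⁻¹ ^ (2 * d) * ν⁻¹ ^ (2 * d)) *
        (2 * π * ν) ^ (P + 2 * d) := by
      rw [pow_add (2 * π * ν), mul_pow (2 * π) ν (2 * d), div_pow, inv_pow, inv_pow, inv_pow]
      field_simp
    rw [e1]
    have e2 : lam⁻¹ ^ P * ((2 * π)⁻¹ ^ (2 * d) * ν⁻¹ ^ (2 * d)) ≤
        K ^ (P + 2 * d) * (1 * (2 ^ d * latW n)) := by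
      gcongr
      · calc lam⁻¹ ^ P ≤ K ^ P := by gcongr
          _ ≤ _ := pow_le_pow_right₀ hK1 (by omega)
      · exact pow_le_one₀ (by positivity) h2pi
    have e3 : 1 / ∏ j, M (r (n j)) ≤
        A * H ^ (P + 2 * d) * M (2 * d) * C₁ * H₁ ^ (P + 2 * d) / M (P + 2 * d) := by
      rw [div_le_div_iff₀ hprodM hMP, one_mul]
      exact hMp
    calc 2 ^ d * (lam⁻¹ ^ P * ((2 * π)⁻¹ ^ (2 * d) * ν⁻¹ ^ (2 * d)) * (2 * π * ν) ^ (P + 2 * d) /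
          ∏ j, M (r (n j)))
        = 2 ^ d * (lam⁻¹ ^ P * ((2 * π)⁻¹ ^ (2 * d) * ν⁻¹ ^ (2 * d))) * (1 / ∏ j, M (r (n j))) *
          (2 * π * ν) ^ (P + 2 * d) := by ring
      _ ≤ 2 ^ d * (K ^ (P + 2 * d) * (1 * (2 ^ d * latW n))) *
          (A * H ^ (P + 2 * d) * M (2 * d) * C₁ * H₁ ^ (P + 2 * d) / M (P + 2 * d)) *
          (2 * π * ν) ^ (P + 2 * d) := by gcongr
      _ = C₂ * latW n * ((K * H * H₁) ^ (P + 2 * d) / M (P + 2 * d)) *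
          (2 * π * ν) ^ (P + 2 * d) := by
        simp only [C₂, mul_pow]; ring
      _ ≤ _ := by gcongr; linarith

end Weight

/-! ### A compactly supported function of one variable in the class -/

/-- A summable sequence of widths adapted to the weight sequence. -/
lemma exists_widths {M : ℕ → ℝ} (hM1 : IsM1 M) (hM3 : IsM3' M) :
    ∃ a : ℕ → ℝ, (∀ k, 0 < a k) ∧ Summable a ∧ ∑' k, a k ≤ 1 / 8 ∧
      ∀ h > 0, ∃ C > 0, ∀ p, ∏ k ∈ Finset.range p, (a k)⁻¹ ≤ C * (h ^ p * M p) := by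
  set r : ℕ → ℝ := fun k => M k / M (k + 1) with hr
  have hr0 : ∀ k, 0 < r k := fun k => div_pos (hM1.1 k) (hM1.1 _)
  set R : ℕ → ℝ := fun k => ∑' j, r (j + k) with hR
  have hsum : ∀ k, Summable fun j => r (j + k) := fun k => (summable_nat_add_iff k).2 hM3
  have hrec : ∀ k, R k = r k + R (k + 1) := by
    intro k
    simp only [hR]
    rw [(hsum k).tsum_eq_zero_add, zero_add]
    congr 2
    funext j
    congr 1
    omega
  have hR0 : ∀ k, 0 < R k := fun k => (hsum k).tsum_pos (fun j => (hr0 _).le) 0 (hr0 _)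
  set b : ℕ → ℝ := fun k => r k / √(R k) with hb
  have hb0 : ∀ k, 0 < b k := fun k => div_pos (hr0 k) (Real.sqrt_pos.2 (hR0 k))
  have hb1 : ∀ k, b k ≤ 2 * (√(R k) - √(R (k + 1))) := by
    intro k
    simp only [hb]
    rw [div_le_iff₀ (Real.sqrt_pos.2 (hR0 k))]
    have h1 := Real.sq_sqrt (hR0 k).le
    have h2 := Real.sq_sqrt (hR0 (k + 1)).le
    have h3 := hrec k
    have h4 : √(R (k + 1)) ≤ √(R k) := Real.sqrt_le_sqrt (by linarith [hr0 k])
    nlinarith [Real.sqrt_nonneg (R k), Real.sqrt_nonneg (R (k + 1))]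
  have hbs : Summable b := by
    refine summable_of_sum_range_le (c := 2 * √(R 0)) (fun k => (hb0 k).le) fun n => ?_
    have : ∑ k ∈ Finset.range n, b k ≤ 2 * (√(R 0) - √(R n)) := by
      induction n with
      | zero => simp
      | succ n ih =>
        rw [Finset.sum_range_succ]
        linarith [hb1 n]
    linarith [Real.sqrt_nonneg (R n)]
  have hB : 0 ≤ ∑' k, b k := tsum_nonneg fun k => (hb0 k).le
  set c : ℝ := 1 / (8 * (∑' k, b k + 1))
  have hc : 0 < c := by positivity
  refine ⟨fun k => c * b k, fun k => mul_pos hc (hb0 k), hbs.mul_left c, ?_, fun h hh => ?_⟩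
  · rw [tsum_mul_left]
    simp only [c]
    rw [div_mul_eq_mul_div, div_le_div_iff₀ (by positivity) (by norm_num)]
    linarith
  · have ht : Filter.Tendsto (fun k => √(R k) / c) Filter.atTop (nhds 0) := by
      have h1 := (Real.continuous_sqrt.tendsto 0).comp (tendsto_sum_nat_add r)
      simpa using h1.div_const c
    obtain ⟨C, hC, h1⟩ := prod_le_const_mul_pow (fun k => by positivity) ht hh
    refine ⟨C / M 0, div_pos hC (hM1.1 0), fun p => ?_⟩
    have h2 : ∏ k ∈ Finset.range p, (M (k + 1) / M k) = M p / M 0 :=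
      Finset.prod_range_induction _ (fun p => M p / M 0) (div_self (hM1.1 0).ne') p (fun k _ => by
        have := (hM1.1 k).ne'
        have := (hM1.1 0).ne'
        field_simp)
    have h3 : ∏ k ∈ Finset.range p, (c * b k)⁻¹ =
        (∏ k ∈ Finset.range p, √(R k) / c) * (M p / M 0) := by
      rw [← h2, ← Finset.prod_mul_distrib]
      refine Finset.prod_congr rfl fun k _ => ?_
      simp only [hb, hr]
      have := (hM1.1 k).ne'
      have := (hM1.1 (k + 1)).ne'
      field_simp
    rw [h3]
    calc _ ≤ C * h ^ p * (M p / M 0) := by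
          gcongr
          · exact (div_pos (hM1.1 p) (hM1.1 0)).le
          · exact h1 p
      _ = _ := by ring

/-- The mean of `g` over intervals of half-length `a`. -/
def avg (a : ℝ) (g : ℝ → ℂ) (x : ℝ) : ℂ := (((2 * a)⁻¹ : ℝ) : ℂ) * ∫ t in (-a)..a, g (x + t)

lemma norm_avg_le {a : ℝ} (ha : 0 < a) {g : ℝ → ℂ} {x B : ℝ}
    (h : ∀ t, |t| ≤ a → ‖g (x + t)‖ ≤ B) : ‖avg a g x‖ ≤ B := by
  have h1 : ‖∫ t in (-a)..a, g (x + t)‖ ≤ B * |a - -a| := by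
    refine intervalIntegral.norm_integral_le_of_norm_le_const fun t ht => h t ?_
    rw [Set.uIoc_of_le (by linarith)] at ht
    exact abs_le.2 ⟨ht.1.le, ht.2⟩
  rw [avg, norm_mul, Complex.norm_real, Real.norm_eq_abs, abs_of_pos (by positivity)]
  calc (2 * a)⁻¹ * ‖∫ t in (-a)..a, g (x + t)‖ ≤ (2 * a)⁻¹ * (B * |a - -a|) := by gcongr
    _ = B := by rw [abs_of_pos (by linarith)]; field_simp; ring

lemma avg_sub {a : ℝ} {g g' : ℝ → ℂ} (hg : Continuous g) (hg' : Continuous g') (x y : ℝ) :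
    avg a g x - avg a g' y = avg a (fun t => g (x + t) - g' (y + t)) 0 := by
  simp only [avg, zero_add]
  rw [intervalIntegral.integral_sub, mul_sub]
  · exact (by fun_prop : Continuous fun t => g (x + t)).intervalIntegrable _ _
  · exact (by fun_prop : Continuous fun t => g' (y + t)).intervalIntegrable _ _

lemma avg_const {a : ℝ} (ha : 0 < a) (z : ℂ) (x : ℝ) : avg a (fun _ => z) x = z := by
  have : (a : ℂ) ≠ 0 := by exact_mod_cast ha.ne'
  simp only [avg, intervalIntegral.integral_const, Complex.real_smul]
  push_cast
  field_simp
  ring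

lemma hasDerivAt_avg {a : ℝ} {g : ℝ → ℂ} (hg : Continuous g) (x : ℝ) :
    HasDerivAt (avg a g) ((((2 * a)⁻¹ : ℝ) : ℂ) * (g (x + a) - g (x - a))) x := by
  have e : avg a g = fun x => (((2 * a)⁻¹ : ℝ) : ℂ) *
      ((∫ t in (0 : ℝ)..(x + a), g t) - ∫ t in (0 : ℝ)..(x - a), g t) := by
    funext x
    rw [avg, intervalIntegral.integral_comp_add_left, intervalIntegral.integral_interval_sub_left
      (hg.intervalIntegrable _ _) (hg.intervalIntegrable _ _), sub_eq_add_neg x a]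
  rw [e]
  refine HasDerivAt.const_mul _ (HasDerivAt.sub ?_ ?_)
  · exact (hg.integral_hasStrictDerivAt 0 (x + a)).hasDerivAt.comp_add_const x a
  · exact (hg.integral_hasStrictDerivAt 0 (x - a)).hasDerivAt.comp_sub_const x a

/-- The tent function of half-width and height `1 / 4`. -/
def tent (x : ℝ) : ℂ := ((max 0 (1 / 4 - |x|) : ℝ) : ℂ)

lemma norm_tent_sub_le (x y : ℝ) : ‖tent x - tent y‖ ≤ |x - y| := by
  rw [tent, tent, ← Complex.ofReal_sub, Complex.norm_real, Real.norm_eq_abs]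
  refine (abs_max_sub_max_le_max _ _ _ _).trans ?_
  rw [sub_self, abs_zero, max_eq_right (abs_nonneg _), sub_sub_sub_cancel_left, abs_sub_comm x y]
  exact abs_abs_sub_abs_le _ _

/-- Iterated means of the tent function over intervals of half-lengths `a p, a (p + 1), …`. -/
def iterAvg (a : ℕ → ℝ) : ℕ → ℕ → ℝ → ℂ
  | 0, _ => tent
  | N + 1, p => avg (a p) (iterAvg a N (p + 1))

section IterAvg

variable {a : ℕ → ℝ}

lemma continuous_of_norm_sub_le {g : ℝ → ℂ} (h : ∀ x y, ‖g x - g y‖ ≤ |x - y|) : Continuous g :=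
  (LipschitzWith.of_dist_le_mul (K := 1) fun x y => by
    simpa [dist_eq_norm] using h x y).continuous

lemma norm_iterAvg_sub_le (ha : ∀ k, 0 < a k) (N p : ℕ) (x y : ℝ) :
    ‖iterAvg a N p x - iterAvg a N p y‖ ≤ |x - y| := by
  induction N generalizing p x y with
  | zero => exact norm_tent_sub_le x y
  | succ N ih =>
    have hc := continuous_of_norm_sub_le (ih (p + 1))
    rw [iterAvg, avg_sub hc hc]
    refine norm_avg_le (ha p) fun t _ => (ih _ _ _).trans_eq ?_
    ring_nf

lemma continuous_iterAvg (ha : ∀ k, 0 < a k) (N p : ℕ) : Continuous (iterAvg a N p) :=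
  continuous_of_norm_sub_le (norm_iterAvg_sub_le ha N p)

lemma norm_iterAvg_le (ha : ∀ k, 0 < a k) (N p : ℕ) (x : ℝ) : ‖iterAvg a N p x‖ ≤ 1 := by
  induction N generalizing p x with
  | zero =>
    rw [iterAvg, tent, Complex.norm_real, Real.norm_eq_abs, abs_of_nonneg (le_max_left _ _)]
    exact max_le zero_le_one (by linarith [abs_nonneg x])
  | succ N ih => exact norm_avg_le (ha p) fun t _ => ih _ _

lemma norm_iterAvg_succ_sub_le (ha : ∀ k, 0 < a k) (N p : ℕ) (x : ℝ) :
    ‖iterAvg a (N + 1) p x - iterAvg a N p x‖ ≤ a (N + p) := by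
  induction N generalizing p x with
  | zero =>
    have hc : Continuous tent := continuous_of_norm_sub_le norm_tent_sub_le
    change ‖avg (a p) tent x - tent x‖ ≤ _
    rw [← avg_const (ha p) (tent x) x, avg_sub hc continuous_const, zero_add]
    refine norm_avg_le (ha p) fun t ht => (norm_tent_sub_le _ _).trans ?_
    simpa using ht
  | succ N ih =>
    change ‖avg (a p) (iterAvg a (N + 1) (p + 1)) x - avg (a p) (iterAvg a N (p + 1)) x‖ ≤ _
    rw [avg_sub (continuous_iterAvg ha _ _) (continuous_iterAvg ha _ _)]
    refine norm_avg_le (ha p) fun t _ => (ih _ _).trans_eq ?_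
    congr 1
    ring

lemma iterAvg_eq_zero (ha : ∀ k, 0 < a k) (N p : ℕ) (x : ℝ)
    (hx : 1 / 4 + ∑ k ∈ Finset.range N, a (p + k) ≤ |x|) : iterAvg a N p x = 0 := by
  induction N generalizing p x with
  | zero =>
    simp only [Finset.range_zero, Finset.sum_empty, add_zero] at hx
    simp only [iterAvg, tent, Complex.ofReal_eq_zero]
    exact max_eq_left (by linarith)
  | succ N ih =>
    rw [Finset.sum_range_succ'] at hx
    rw [← norm_le_zero_iff]
    refine norm_avg_le (ha p) fun t ht => (norm_le_zero_iff.2 (ih _ _ ?_))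
    have h1 : |x| ≤ |x + t| + |t| := by
      have := abs_sub (x + t) t
      simpa using this
    have h2 : ∑ k ∈ Finset.range N, a (p + 1 + k) = ∑ k ∈ Finset.range N, a (p + (k + 1)) :=
      Finset.sum_congr rfl fun k _ => by congr 1; ring
    simp only [add_zero] at hx
    linarith

lemma exists_limit_iterAvg (ha : ∀ k, 0 < a k) (hs : Summable a) (p : ℕ) (x : ℝ) :
    ∃ z, Filter.Tendsto (fun N => iterAvg a N p x) Filter.atTop (nhds z) ∧
      ∀ N, ‖iterAvg a N p x - z‖ ≤ ∑' k, a (N + k + p) := by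
  have hs' : Summable fun N => a (N + p) := (summable_nat_add_iff p).2 hs
  have hd : ∀ N, dist (iterAvg a N p x) (iterAvg a (N + 1) p x) ≤ a (N + p) := fun N => by
    rw [dist_comm, dist_eq_norm]
    exact norm_iterAvg_succ_sub_le ha N p x
  obtain ⟨z, hz⟩ := cauchySeq_tendsto_of_complete (cauchySeq_of_dist_le_of_summable _ hd hs')
  refine ⟨z, hz, fun N => ?_⟩
  have := dist_le_tsum_of_dist_le_of_tendsto _ hd hs' hz N
  rwa [dist_eq_norm] at this

/-- The class of weight sequences satisfying (M.3)' is non-quasianalytic. -/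
lemma exists_bump_one_dim {M : ℕ → ℝ} (hM1 : IsM1 M) (hM3 : IsM3' M) :
    ∃ χ : ℝ → ℂ, ContDiff ℝ (⊤ : ℕ∞) χ ∧ χ 0 = 1 ∧ (∀ x, 3 / 8 ≤ |x| → χ x = 0) ∧
      ∀ h > 0, ∃ C > 0, ∀ k x, ‖iteratedDeriv k χ x‖ ≤ C * (h ^ k * M k) := by
  obtain ⟨a, ha, hs, hle, hprod⟩ := exists_widths hM1 hM3
  choose v hv hvd using exists_limit_iterAvg ha hs
  have hlip : ∀ p x y, ‖v p x - v p y‖ ≤ |x - y| := fun p x y =>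
    le_of_tendsto ((hv p x).sub (hv p y)).norm
      (Filter.Eventually.of_forall fun N => norm_iterAvg_sub_le ha N p x y)
  have hc : ∀ p, Continuous (v p) := fun p => continuous_of_norm_sub_le (hlip p)
  have hv1 : ∀ p x, ‖v p x‖ ≤ 1 := fun p x =>
    le_of_tendsto (hv p x).norm (Filter.Eventually.of_forall fun N => norm_iterAvg_le ha N p x)
  have hv0 : ∀ x, 3 / 8 ≤ |x| → v 0 x = 0 := fun x hx => by
    refine tendsto_nhds_unique (hv 0 x) ?_
    refine tendsto_const_nhds.congr fun N => (iterAvg_eq_zero ha N 0 x ?_).symm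
    have := hs.sum_le_tsum (Finset.range N) fun k _ => (ha k).le
    simp only [zero_add]
    linarith
  have havg : ∀ p, v p = avg (a p) (v (p + 1)) := by
    intro p
    funext x
    refine tendsto_nhds_unique ((hv p x).comp (Filter.tendsto_add_atTop_nat 1)) ?_
    rw [tendsto_iff_norm_sub_tendsto_zero]
    refine squeeze_zero (fun _ => norm_nonneg _) (g := fun N => ∑' k, a (k + (N + (p + 1))))
      (fun N => ?_) ?_
    · simp only [Function.comp, iterAvg]
      rw [avg_sub (continuous_iterAvg ha _ _) (hc _)]
      refine norm_avg_le (ha p) fun t _ => (hvd _ _ N).trans_eq ?_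
      congr 1
      funext k
      congr 1
      ring
    · have := (tendsto_sum_nat_add a).comp (Filter.tendsto_add_atTop_nat (p + 1))
      exact this
  have hderiv : ∀ p, deriv (v p) = fun x => (((2 * a p)⁻¹ : ℝ) : ℂ) *
      (v (p + 1) (x + a p) - v (p + 1) (x - a p)) := by
    intro p
    funext x
    rw [havg p]
    exact (hasDerivAt_avg (hc _) x).deriv
  have hdiff : ∀ p, Differentiable ℝ (v p) := fun p x => by
    rw [havg p]
    exact (hasDerivAt_avg (hc _) x).differentiableAt
  have hcd : ∀ k : ℕ, ∀ p, ContDiff ℝ k (v p) := by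
    intro k
    induction k with
    | zero => intro p; exact contDiff_zero.2 (hc p)
    | succ k ih =>
      intro p
      rw [Nat.cast_add, Nat.cast_one, contDiff_succ_iff_deriv]
      refine ⟨hdiff p, by simp, ?_⟩
      rw [hderiv p]
      have := ih (p + 1)
      exact contDiff_const.mul ((this.comp (contDiff_id.add contDiff_const)).sub
        (this.comp (contDiff_id.sub contDiff_const)))
  have hbd : ∀ k p x, ‖iteratedDeriv k (v p) x‖ ≤ ∏ j ∈ Finset.range k, (a (p + j))⁻¹ := by
    intro k
    induction k with
    | zero => intro p x; simpa using hv1 p x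
    | succ k ih =>
      intro p x
      have hap := ha p
      rw [iteratedDeriv_succ', hderiv p, iteratedDeriv_const_mul_field]
      have c1 : ContDiff ℝ k fun x => v (p + 1) (x + a p) :=
        (hcd k (p + 1)).comp (contDiff_id.add contDiff_const)
      have c2 : ContDiff ℝ k fun x => v (p + 1) (x - a p) :=
        (hcd k (p + 1)).comp (contDiff_id.sub contDiff_const)
      rw [show (fun x => v (p + 1) (x + a p) - v (p + 1) (x - a p)) =
        (fun x => v (p + 1) (x + a p)) - fun x => v (p + 1) (x - a p) from rfl,
        iteratedDeriv_sub c1.contDiffAt c2.contDiffAt,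
        iteratedDeriv_comp_add_const, iteratedDeriv_comp_sub_const]
      have hp : 0 ≤ ∏ j ∈ Finset.range k, (a (p + 1 + j))⁻¹ :=
        Finset.prod_nonneg fun j _ => (inv_pos.2 (ha _)).le
      rw [norm_mul, Complex.norm_real, Real.norm_eq_abs, abs_of_pos (by positivity)]
      have h1 := norm_sub_le (iteratedDeriv k (v (p + 1)) (x + a p))
        (iteratedDeriv k (v (p + 1)) (x - a p))
      have h2 := ih (p + 1) (x + a p)
      have h3 := ih (p + 1) (x - a p)
      calc _ ≤ (2 * a p)⁻¹ * (2 * ∏ j ∈ Finset.range k, (a (p + 1 + j))⁻¹) := by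
            gcongr; linarith
        _ = _ := by
          rw [Finset.prod_range_succ', add_zero]
          have : ∏ j ∈ Finset.range k, (a (p + 1 + j))⁻¹ =
              ∏ j ∈ Finset.range k, (a (p + (j + 1)))⁻¹ :=
            Finset.prod_congr rfl fun j _ => by congr 2; ring
          rw [this]
          field_simp
  have h00 : v 0 0 ≠ 0 := by
    intro h
    have h1 := hvd 0 0 0
    simp only [zero_add, add_zero, h, sub_zero, iterAvg, tent, abs_zero, Complex.norm_real,
      Real.norm_eq_abs] at h1
    rw [abs_of_nonneg (le_max_left _ _), max_eq_right (by norm_num)] at h1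
    linarith
  have hcd' : ContDiff ℝ (⊤ : ℕ∞) (v 0) := contDiff_infty.2 fun k => hcd k 0
  refine ⟨fun x => (v 0 0)⁻¹ * v 0 x, contDiff_const.mul hcd', inv_mul_cancel₀ h00,
    fun x hx => by simp [hv0 x hx], fun h hh => ?_⟩
  obtain ⟨C, hC, h1⟩ := hprod h hh
  refine ⟨‖(v 0 0)⁻¹‖ * C, mul_pos (norm_pos_iff.2 (inv_ne_zero h00)) hC, fun k x => ?_⟩
  rw [iteratedDeriv_const_mul_field, norm_mul, mul_assoc]
  gcongr
  refine (hbd k 0 x).trans ?_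
  simpa using h1 k

end IterAvg

/-! ### Test functions -/

/-- The bound `‖∂^α φ‖ ≤ B ℓ^|α| M_|α|` on all of `ℝ^d`. -/
def EBound (M : ℕ → ℝ) (ℓ B : ℝ) (φ : Rd d → ℂ) : Prop :=
  ∀ α x, ‖mderiv α φ x‖ ≤ B * (ℓ ^ mOrd α * M (mOrd α))

lemma EBound.nonneg {M : ℕ → ℝ} (hM1 : IsM1 M) {ℓ B : ℝ} {φ : Rd d → ℂ} (h : EBound M ℓ B φ) :
    0 ≤ B := by
  have h1 := (norm_nonneg _).trans (h 0 0)
  have h2 := hM1.1 0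
  simp only [mOrd_zero, pow_zero, one_mul] at h1
  exact nonneg_of_mul_nonneg_left h1 h2

lemma EBound.mono {M : ℕ → ℝ} (hM1 : IsM1 M) {ℓ B B' : ℝ} (hℓ : 0 < ℓ) (hB : B ≤ B')
    {φ : Rd d → ℂ} (h : EBound M ℓ B φ) : EBound M ℓ B' φ := fun α x =>
  (h α x).trans (mul_le_mul_of_nonneg_right hB (by have := hM1.1 (mOrd α); positivity))

lemma EBound.translate {M : ℕ → ℝ} {ℓ B : ℝ} {φ : Rd d → ℂ} (hφ : ContDiff ℝ (⊤ : ℕ∞) φ)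
    (h : EBound M ℓ B φ) (y : Rd d) : EBound M ℓ B fun x => φ (x - y) := fun α x => by
  rw [mderiv_translate hφ]
  exact h α (x - y)

lemma EBound.const_smul {M : ℕ → ℝ} {ℓ B : ℝ} {φ : Rd d → ℂ} (hφ : ContDiff ℝ (⊤ : ℕ∞) φ)
    (h : EBound M ℓ B φ) (c : ℂ) : EBound M ℓ (‖c‖ * B) (c • φ) := fun α x => by
  rw [mderiv_const_smul hφ, Pi.smul_apply, norm_smul, mul_assoc]
  exact mul_le_mul_of_nonneg_left (h α x) (norm_nonneg c)

lemma EBound.add {M : ℕ → ℝ} {ℓ B B' : ℝ} {φ ψ : Rd d → ℂ} (hφ : ContDiff ℝ (⊤ : ℕ∞) φ)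
    (hψ : ContDiff ℝ (⊤ : ℕ∞) ψ) (h : EBound M ℓ B φ) (h' : EBound M ℓ B' ψ) :
    EBound M ℓ (B + B') (φ + ψ) := fun α x => by
  rw [mderiv_fun_add hφ hψ, add_mul]
  exact (norm_add_le _ _).trans (add_le_add (h α x) (h' α x))

lemma isTestD_iff {M : ℕ → ℝ} (hM1 : IsM1 M) {φ : Rd d → ℂ} :
    IsTestD M φ ↔ ContDiff ℝ (⊤ : ℕ∞) φ ∧ HasCompactSupport φ ∧ ∀ ℓ > 0, ∃ B, EBound M ℓ B φ := by
  refine and_congr_right fun hφ => and_congr_right fun _ => forall₂_congr fun ℓ hℓ => ?_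
  have hp : ∀ α : Fin d → ℕ, 0 < ℓ ^ mOrd α * M (mOrd α) := fun α =>
    mul_pos (pow_pos hℓ _) (hM1.1 _)
  constructor
  · rintro ⟨B, hB⟩
    refine ⟨max B 0, fun α x => ?_⟩
    by_cases hx : x ∈ tsupport φ
    · have := hB ⟨α, x, hx, rfl⟩
      rw [div_le_iff₀ (hp α)] at this
      exact this.trans (mul_le_mul_of_nonneg_right (le_max_left _ _) (hp α).le)
    · rw [image_eq_zero_of_notMem_tsupport fun h => hx (tsupport_mderiv_subset hφ α h), norm_zero]
      exact mul_nonneg (le_max_right _ _) (hp α).le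
  · rintro ⟨B, hB⟩
    refine ⟨B, ?_⟩
    rintro _ ⟨α, x, -, rfl⟩
    rw [div_le_iff₀ (hp α)]
    exact hB α x

lemma IsUltraD.exists_bound {M : ℕ → ℝ} (hM1 : IsM1 M) {f : (Rd d → ℂ) →ₗ[ℂ] ℂ}
    (hf : IsUltraD M f) {K : Set (Rd d)} (hK : IsCompact K) :
    ∃ ℓ > 0, ∃ C > 0, ∀ (φ : Rd d → ℂ) (B : ℝ), IsTestD M φ → tsupport φ ⊆ K →
      EBound M ℓ B φ → ‖f φ‖ ≤ C * B := by
  obtain ⟨ℓ, hℓ, C, hC, h⟩ := hf K hK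
  refine ⟨ℓ, hℓ, C, hC, fun φ B hφ hφK hB => (h φ hφ hφK).trans ?_⟩
  refine mul_le_mul_of_nonneg_left (Real.sSup_le ?_ (hB.nonneg hM1)) hC.le
  rintro _ ⟨α, x, -, rfl⟩
  rw [div_le_iff₀ (mul_pos (pow_pos hℓ _) (hM1.1 _))]
  exact hB α x

lemma IsTestD.translate {M : ℕ → ℝ} (hM1 : IsM1 M) {φ : Rd d → ℂ} (hφ : IsTestD M φ) (y : Rd d) :
    IsTestD M fun x => φ (x - y) := by
  rw [isTestD_iff hM1] at hφ ⊢
  obtain ⟨h1, h2, h3⟩ := hφ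
  refine ⟨contDiff_translate h1 y, h2.comp_homeomorph (Homeomorph.subRight y), fun ℓ hℓ => ?_⟩
  obtain ⟨B, hB⟩ := h3 ℓ hℓ
  exact ⟨B, hB.translate h1 y⟩

lemma IsTestD.const_smul {M : ℕ → ℝ} (hM1 : IsM1 M) {φ : Rd d → ℂ} (hφ : IsTestD M φ) (c : ℂ) :
    IsTestD M (c • φ) := by
  rw [isTestD_iff hM1] at hφ ⊢
  obtain ⟨h1, h2, h3⟩ := hφ
  refine ⟨h1.const_smul c, h2.smul_left (f := fun _ => c), fun ℓ hℓ => ?_⟩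
  obtain ⟨B, hB⟩ := h3 ℓ hℓ
  exact ⟨_, hB.const_smul h1 c⟩

lemma IsTestD.add {M : ℕ → ℝ} (hM1 : IsM1 M) {φ ψ : Rd d → ℂ} (hφ : IsTestD M φ)
    (hψ : IsTestD M ψ) : IsTestD M (φ + ψ) := by
  rw [isTestD_iff hM1] at hφ hψ ⊢
  obtain ⟨h1, h2, h3⟩ := hφ
  obtain ⟨h1', h2', h3'⟩ := hψ
  refine ⟨h1.add h1', h2.add h2', fun ℓ hℓ => ?_⟩
  obtain ⟨B, hB⟩ := h3 ℓ hℓ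
  obtain ⟨B', hBψ⟩ := h3' ℓ hℓ
  exact ⟨_, hB.add h1 h1' hBψ⟩

/-! ### Products of functions of one variable -/

/-- The function `x ↦ ∏ g_j(x_j)`. -/
def tensorFn (g : Fin d → ℝ → ℂ) (x : Rd d) : ℂ := ∏ j, g j (x j)

lemma hasFDerivAt_tensorFn {g g' : Fin d → ℝ → ℂ} (x : Rd d)
    (h : ∀ j, HasDerivAt (g j) (g' j (x j)) (x j)) :
    HasFDerivAt (tensorFn g) (jetD fun i => tensorFn (Function.update g i (g' i)) x) x := by
  have h1 : ∀ j, HasFDerivAt (fun x : Rd d => g j (x j))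
      ((EuclideanSpace.proj j : Rd d →L[ℝ] ℝ).smulRight (g' j (x j))) x := fun j => by
    have hp : HasFDerivAt (fun x : Rd d => x j) (EuclideanSpace.proj j : Rd d →L[ℝ] ℝ) x :=
      (EuclideanSpace.proj j : Rd d →L[ℝ] ℝ).hasFDerivAt
    have := HasFDerivAt.comp x (h j).hasFDerivAt hp
    exact this.congr_fderiv (by ext v; simp)
  have h2 := HasFDerivAt.finsetProd (u := Finset.univ) fun j _ => h1 j
  refine h2.congr_fderiv ?_
  · unfold jetD
    refine Finset.sum_congr rfl fun i _ => ?_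
    ext v
    simp only [tensorFn, ContinuousLinearMap.smulRight_apply, smul_apply,
      Complex.real_smul, smul_eq_mul]
    rw [← Finset.mul_prod_erase _ _ (Finset.mem_univ i), Function.update_self]
    have : ∏ j ∈ Finset.univ.erase i, Function.update g i (g' i) j (x j) =
        ∏ j ∈ Finset.univ.erase i, g j (x j) :=
      Finset.prod_congr rfl fun j hj => by
        rw [Function.update_of_ne (Finset.ne_of_mem_erase hj)]
    rw [this]
    ring

lemma hasDerivAt_iteratedDeriv {g : ℝ → ℂ} (hg : ContDiff ℝ (⊤ : ℕ∞) g) (k : ℕ) (t : ℝ) :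
    HasDerivAt (iteratedDeriv k g) (iteratedDeriv (k + 1) g t) t := by
  rw [iteratedDeriv_succ]
  exact ((hg.differentiable_iteratedDeriv k (by exact_mod_cast WithTop.coe_lt_top k)) t).hasDerivAt

lemma tensorFn_jet {g : Fin d → ℝ → ℂ} (hg : ∀ j, ContDiff ℝ (⊤ : ℕ∞) (g j)) :
    ContDiff ℝ (⊤ : ℕ∞) (tensorFn g) ∧
      ∀ α, mderiv α (tensorFn g) = tensorFn fun j => iteratedDeriv (α j) (g j) := by
  have := jet_criterion (F := fun α => tensorFn fun j => iteratedDeriv (α j) (g j)) fun α x => by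
    have h := hasFDerivAt_tensorFn (g' := fun j => iteratedDeriv (α j + 1) (g j)) x fun j =>
      hasDerivAt_iteratedDeriv (hg j) (α j) (x j)
    refine h.congr_fderiv ?_
    congr 1
    funext i
    congr 1
    funext j
    by_cases hj : j = i
    · subst hj; simp
    · simp [Function.update_of_ne hj, Pi.single_eq_of_ne hj]
  simpa using this

lemma pder_tensorFn {g g' : Fin d → ℝ → ℂ} (h : ∀ j t, HasDerivAt (g j) (g' j t) t) (i : Fin d) :
    pder i (tensorFn g) = tensorFn (Function.update g i (g' i)) := by
  funext x
  rw [pder, (hasFDerivAt_tensorFn x fun j => h j (x j)).fderiv, jetD_single]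

/-- A derivative of `χ` modulated by the frequency `ν`. -/
def modFn (χ : ℝ → ℂ) (ν : ℤ) (k : ℕ) (t : ℝ) : ℂ :=
  iteratedDeriv k χ t * Complex.exp (2 * π * Complex.I * ν * t)

lemma hasDerivAt_cexp_mul (c : ℂ) (t : ℝ) :
    HasDerivAt (fun t : ℝ => Complex.exp (c * t)) (c * Complex.exp (c * t)) t := by
  have h1 : HasDerivAt (fun t : ℝ => c * (t : ℂ)) c t := by
    simpa using (Complex.ofRealCLM.hasDerivAt (x := t)).const_mul c
  simpa [mul_comm] using h1.cexp

lemma iteratedDeriv_cexp_mul (c : ℂ) (s : ℕ) :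
    iteratedDeriv s (fun t : ℝ => Complex.exp (c * t)) = fun t : ℝ => c ^ s * Complex.exp (c * t) := by
  induction s with
  | zero => simp
  | succ s ih =>
    rw [iteratedDeriv_succ, ih]
    funext t
    rw [((hasDerivAt_cexp_mul c t).const_mul (c ^ s)).deriv]
    ring

lemma contDiff_cexp_mul (c : ℂ) : ContDiff ℝ (⊤ : ℕ∞) fun t : ℝ => Complex.exp (c * t) := by
  have : ContDiff ℝ (⊤ : ℕ∞) fun t : ℝ => (t : ℂ) := Complex.ofRealCLM.contDiff
  exact (contDiff_const.mul this).cexp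

lemma iteratedDeriv_iteratedDeriv' (g : ℝ → ℂ) (m k : ℕ) :
    iteratedDeriv m (iteratedDeriv k g) = iteratedDeriv (k + m) g := by
  rw [iteratedDeriv_eq_iterate, iteratedDeriv_eq_iterate, iteratedDeriv_eq_iterate,
    ← Function.iterate_add_apply, add_comm]

lemma contDiff_iteratedDeriv {g : ℝ → ℂ} (hg : ContDiff ℝ (⊤ : ℕ∞) g) (k : ℕ) :
    ContDiff ℝ (⊤ : ℕ∞) (iteratedDeriv k g) := by
  induction k with
  | zero => simpa using hg
  | succ k ih => rw [iteratedDeriv_succ]; exact (contDiff_infty_iff_deriv.1 ih).2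

section ModFn

variable {χ : ℝ → ℂ}

lemma contDiff_modFn (hχ : ContDiff ℝ (⊤ : ℕ∞) χ) (ν : ℤ) (k : ℕ) : ContDiff ℝ (⊤ : ℕ∞) (modFn χ ν k) :=
  (contDiff_iteratedDeriv hχ k).mul (contDiff_cexp_mul _)

lemma hasDerivAt_modFn (hχ : ContDiff ℝ (⊤ : ℕ∞) χ) (ν : ℤ) (k : ℕ) (t : ℝ) :
    HasDerivAt (modFn χ ν k) (modFn χ ν (k + 1) t + 2 * π * Complex.I * ν * modFn χ ν k t) t := by
  refine ((hasDerivAt_iteratedDeriv hχ k t).mul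
    (hasDerivAt_cexp_mul (2 * π * Complex.I * ν) t)).congr_deriv ?_
  simp only [modFn]
  ring

end ModFn

section BumpFn

variable {M : ℕ → ℝ} {χ : ℝ → ℂ}

lemma norm_iteratedDeriv_modFn_le (hM1 : IsM1 M) (hM2 : IsM2 M) (hχ : ContDiff ℝ (⊤ : ℕ∞) χ)
    (hb : ∀ h > 0, ∃ C > 0, ∀ k x, ‖iteratedDeriv k χ x‖ ≤ C * (h ^ k * M k)) {lam h' : ℝ}
    (hlam : 0 < lam) (hh' : 0 < h') :
    ∃ C > 0, ∀ (ν : ℤ) (E : ℝ), (∀ s : ℕ, (2 * π * |(ν : ℝ)| / lam) ^ s / M s ≤ E) →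
      ∀ (k s : ℕ) (t : ℝ), ‖iteratedDeriv s (modFn χ ν k) t‖ ≤
        C * (h' ^ k * M k) * E * ((2 * lam) ^ s * M s) := by
  have hpi := Real.pi_pos
  obtain ⟨A, H, hA, hH, hAH⟩ := hM2
  have hH0 : 0 < H := by linarith
  set h := min lam h' / H with hh
  have hh0 : 0 < h := by positivity
  have hhl : h * H ≤ lam := by rw [hh, div_mul_cancel₀ _ hH0.ne']; exact min_le_left _ _
  have hhh : h * H ≤ h' := by rw [hh, div_mul_cancel₀ _ hH0.ne']; exact min_le_right _ _
  obtain ⟨C, hC, hb⟩ := hb h hh0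
  have hM0 := hM1.1 0
  refine ⟨C * A * M 0, by positivity, fun ν E hE k s t => ?_⟩
  have hE0 : 0 < E := lt_of_lt_of_le (by simpa using hM0) (hE 0)
  have hMk := hM1.1 k
  have hMs := hM1.1 s
  have hn : ‖(2 * π * Complex.I * ν : ℂ)‖ = 2 * π * |(ν : ℝ)| := by
    simp [abs_of_pos hpi]
  have hexp : ‖Complex.exp (2 * π * Complex.I * ν * t)‖ = 1 := by
    rw [show (2 * π * Complex.I * ν * t : ℂ) = ((2 * π * ν * t : ℝ) : ℂ) * Complex.I by
      push_cast; ring, Complex.norm_exp_ofReal_mul_I]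
  have hkm : ∀ m, h ^ (k + m) * M (k + m) ≤ A * (h' ^ k * M k) * (lam ^ m * M m) := by
    intro m
    have hMm := hM1.1 m
    calc h ^ (k + m) * M (k + m) ≤ h ^ (k + m) * (A * H ^ (k + m) * M k * M m) := by
          gcongr; exact hAH k m
      _ = A * ((h * H) ^ k * M k) * ((h * H) ^ m * M m) := by rw [mul_pow, mul_pow]; ring
      _ ≤ _ := by gcongr
  unfold modFn
  rw [iteratedDeriv_fun_mul ((contDiff_iteratedDeriv hχ k).of_le (by exact_mod_cast le_top)).contDiffAt
    ((contDiff_cexp_mul _).of_le (by exact_mod_cast le_top)).contDiffAt]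
  refine (norm_sum_le _ _).trans ?_
  have hterm : ∀ m ∈ Finset.range (s + 1),
      ‖((s.choose m : ℕ) : ℂ) * iteratedDeriv m (iteratedDeriv k χ) t *
        iteratedDeriv (s - m) (fun t : ℝ => Complex.exp (2 * π * Complex.I * ν * t)) t‖ ≤
      (s.choose m : ℝ) * (C * A * M 0 * (h' ^ k * M k) * E * (lam ^ s * M s)) := by
    intro m hm
    have hms : m ≤ s := Nat.lt_succ_iff.1 (Finset.mem_range.1 hm)
    have hMm := hM1.1 m
    have hMsm := hM1.1 (s - m)
    rw [iteratedDeriv_iteratedDeriv', iteratedDeriv_cexp_mul, norm_mul, norm_mul, norm_mul, norm_pow,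
      hn, hexp, Complex.norm_natCast, mul_one, mul_assoc]
    refine mul_le_mul_of_nonneg_left ?_ (Nat.cast_nonneg _)
    have h1 := hE (s - m)
    rw [div_pow, div_le_iff₀ hMsm, div_le_iff₀ (by positivity)] at h1
    calc ‖iteratedDeriv (k + m) χ t‖ * (2 * π * |(ν : ℝ)|) ^ (s - m)
        ≤ (C * (A * (h' ^ k * M k) * (lam ^ m * M m))) * (E * M (s - m) * lam ^ (s - m)) := by
          gcongr
          exact (hb _ _).trans (mul_le_mul_of_nonneg_left (hkm m) hC.le)
      _ = C * A * (h' ^ k * M k) * E * (lam ^ (m + (s - m)) * (M m * M (s - m))) := by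
          rw [pow_add]; ring
      _ ≤ C * A * (h' ^ k * M k) * E * (lam ^ (m + (s - m)) * (M 0 * M (m + (s - m)))) := by
          refine mul_le_mul_of_nonneg_left (mul_le_mul_of_nonneg_left (hM1.mul_le _ _) ?_) ?_ <;>
            positivity
      _ = _ := by rw [Nat.add_sub_cancel' hms]; ring
  refine (Finset.sum_le_sum hterm).trans_eq ?_
  rw [← Finset.sum_mul]
  have := Nat.sum_range_choose s
  have h2 : ∑ m ∈ Finset.range (s + 1), (s.choose m : ℝ) = 2 ^ s := by exact_mod_cast this
  rw [h2, mul_pow]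
  ring

/-- A derivative of the bump function `∏ χ(x_j)`, modulated by the frequency `n`. -/
def bumpFn (χ : ℝ → ℂ) (n : Fin d → ℤ) (κ : Fin d → ℕ) : Rd d → ℂ :=
  tensorFn fun j => modFn χ (n j) (κ j)

lemma contDiff_bumpFn (hχ : ContDiff ℝ (⊤ : ℕ∞) χ) (n : Fin d → ℤ) (κ : Fin d → ℕ) :
    ContDiff ℝ (⊤ : ℕ∞) (bumpFn χ n κ) :=
  (tensorFn_jet fun j => contDiff_modFn hχ (n j) (κ j)).1

lemma eBound_bumpFn (hM1 : IsM1 M) (hM2 : IsM2 M) (hχ : ContDiff ℝ (⊤ : ℕ∞) χ)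
    (hb : ∀ h > 0, ∃ C > 0, ∀ k x, ‖iteratedDeriv k χ x‖ ≤ C * (h ^ k * M k)) {lam h' : ℝ}
    (hlam : 0 < lam) (hh' : 0 < h') :
    ∃ C > 0, ∀ E : ℤ → ℝ, (∀ (ν : ℤ) (s : ℕ), (2 * π * |(ν : ℝ)| / lam) ^ s / M s ≤ E ν) →
      ∀ (n : Fin d → ℤ) (κ : Fin d → ℕ),
        EBound M (2 * lam) (C * (h' ^ mOrd κ * M (mOrd κ)) * ∏ j, E (n j)) (bumpFn χ n κ) := by
  obtain ⟨C, hC, h⟩ := norm_iteratedDeriv_modFn_le hM1 hM2 hχ hb hlam hh'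
  obtain ⟨C₁, hC₁, h₁⟩ := hM1.prod_le (d := d)
  refine ⟨C ^ d * C₁ * C₁, by positivity, fun E hE n κ α x => ?_⟩
  have hE0 : ∀ ν, 0 < E ν := fun ν => lt_of_lt_of_le (by simpa using hM1.1 0) (hE ν 0)
  have hprod : ∀ (c : ℝ) (s : Fin d → ℕ), 0 < c → ∏ j, (c ^ s j * M (s j)) ≤
      C₁ * (c ^ mOrd s * M (mOrd s)) := by
    intro c s hc
    rw [Finset.prod_mul_distrib, Finset.prod_pow_eq_pow_sum]
    calc c ^ mOrd s * ∏ j, M (s j) ≤ c ^ mOrd s * (C₁ * M (mOrd s)) := by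
          gcongr; exact h₁ s
      _ = _ := by ring
  rw [bumpFn, (tensorFn_jet fun j => contDiff_modFn hχ (n j) (κ j)).2 α, tensorFn, norm_prod]
  calc ∏ j, ‖iteratedDeriv (α j) (modFn χ (n j) (κ j)) (x j)‖
      ≤ ∏ j, (C * (h' ^ κ j * M (κ j)) * E (n j) * ((2 * lam) ^ α j * M (α j))) :=
        Finset.prod_le_prod (fun j _ => norm_nonneg _) fun j _ =>
          h (n j) (E (n j)) (hE (n j)) (κ j) (α j) (x j)
    _ = C ^ d * (∏ j, (h' ^ κ j * M (κ j))) * (∏ j, E (n j)) *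
        ∏ j, ((2 * lam) ^ α j * M (α j)) := by
        simp only [Finset.prod_mul_distrib, Finset.prod_const, Finset.card_univ, Fintype.card_fin]
    _ ≤ C ^ d * (C₁ * (h' ^ mOrd κ * M (mOrd κ))) * (∏ j, E (n j)) *
        (C₁ * ((2 * lam) ^ mOrd α * M (mOrd α))) := by
        have p1 : 0 < ∏ j, E (n j) := Finset.prod_pos fun j _ => hE0 _
        have p2 : 0 ≤ ∏ j, ((2 * lam) ^ α j * M (α j)) :=
          Finset.prod_nonneg fun j _ => by have := hM1.1 (α j); positivity
        have p3 := hM1.1 (mOrd κ)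
        gcongr
        · exact hprod _ _ hh'
        · exact hprod _ _ (by positivity)
    _ = _ := by ring

lemma modFn_eq_zero (h0 : ∀ x, 3 / 8 ≤ |x| → χ x = 0) (ν : ℤ) (k : ℕ) {t : ℝ} (ht : 3 / 8 < |t|) :
    modFn χ ν k t = 0 := by
  have : χ =ᶠ[nhds t] fun _ => 0 := by
    filter_upwards [(isOpen_lt continuous_const continuous_abs).mem_nhds ht] with x hx
    exact h0 x (le_of_lt hx)
  rw [modFn, (this.iteratedDeriv k).eq_of_nhds]
  have : ∀ k : ℕ, iteratedDeriv k (fun _ : ℝ => (0 : ℂ)) = fun _ => 0 := by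
    intro k
    induction k with
    | zero => simp
    | succ k ih => rw [iteratedDeriv_succ, ih]; simp
  rw [this]
  simp

lemma bumpFn_eq_zero (h0 : ∀ x, 3 / 8 ≤ |x| → χ x = 0) (n : Fin d → ℤ) (κ : Fin d → ℕ) {x : Rd d}
    {j : Fin d} (hx : 3 / 8 < |x j|) : bumpFn χ n κ x = 0 :=
  Finset.prod_eq_zero (Finset.mem_univ j) (modFn_eq_zero h0 _ _ hx)

lemma norm_le_of_abs_le {x : Rd d} {c : ℝ} (hx : ∀ j, |x j| ≤ c) : ‖x‖ ≤ d * c := by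
  have h1 : x = ∑ j, x j • EuclideanSpace.single j (1 : ℝ) := by
    ext i
    simp [Finset.sum_apply, Pi.single_apply]
  rw [h1]
  refine (norm_sum_le _ _).trans ?_
  calc ∑ j, ‖x j • EuclideanSpace.single j (1 : ℝ)‖ ≤ ∑ _j : Fin d, c :=
        Finset.sum_le_sum fun j _ => by rw [norm_smul]; simpa using hx j
    _ = _ := by simp

lemma tsupport_bumpFn_subset (h0 : ∀ x, 3 / 8 ≤ |x| → χ x = 0) (n : Fin d → ℤ) (κ : Fin d → ℕ) :
    tsupport (bumpFn χ n κ) ⊆ Metric.closedBall 0 d := by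
  refine closure_minimal (fun x hx => ?_) Metric.isClosed_closedBall
  rw [mem_closedBall_zero_iff]
  have : ∀ j, |x j| ≤ 1 := fun j => by
    by_contra! h
    exact hx (bumpFn_eq_zero h0 n κ (j := j) (by linarith))
  simpa using norm_le_of_abs_le this

lemma isTestD_bumpFn (hM1 : IsM1 M) (hM2 : IsM2 M) (hM3 : IsM3' M) (hχ : ContDiff ℝ (⊤ : ℕ∞) χ)
    (h0 : ∀ x, 3 / 8 ≤ |x| → χ x = 0)
    (hb : ∀ h > 0, ∃ C > 0, ∀ k x, ‖iteratedDeriv k χ x‖ ≤ C * (h ^ k * M k))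
    (n : Fin d → ℤ) (κ : Fin d → ℕ) : IsTestD M (bumpFn χ n κ) := by
  rw [isTestD_iff hM1]
  refine ⟨contDiff_bumpFn hχ n κ, (isCompact_closedBall (0 : Rd d) d).of_isClosed_subset
    (isClosed_tsupport _) (tsupport_bumpFn_subset h0 n κ),
    fun ℓ hℓ => ?_⟩
  obtain ⟨C, -, h⟩ := eBound_bumpFn (d := d) hM1 hM2 hχ hb (half_pos hℓ) one_pos
  have hE : ∀ ν : ℤ, ∃ E, ∀ s : ℕ, (2 * π * |(ν : ℝ)| / (ℓ / 2)) ^ s / M s ≤ E := by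
    intro ν
    have hpi := Real.pi_pos
    obtain ⟨r, -, hr⟩ := exists_almost_max hM1 hM3 (ρ := 2 * π * |(ν : ℝ)| / (ℓ / 2)) (by positivity)
    exact ⟨_, hr⟩
  choose E hE using hE
  have := h E hE n κ
  rw [mul_div_cancel₀ ℓ two_ne_zero] at this
  exact ⟨_, this⟩

lemma pder_bumpFn (hχ : ContDiff ℝ (⊤ : ℕ∞) χ) (n : Fin d → ℤ) (κ : Fin d → ℕ) (i : Fin d) :
    pder i (bumpFn χ n κ) = bumpFn χ n (κ + Pi.single i 1) +
      (2 * π * Complex.I * n i : ℂ) • bumpFn χ n κ := by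
  rw [bumpFn, pder_tensorFn fun j t => hasDerivAt_modFn hχ (n j) (κ j) t]
  funext x
  simp only [Pi.add_apply, Pi.smul_apply, smul_eq_mul, bumpFn, tensorFn]
  have h1 : ∀ g : Fin d → ℝ → ℂ, ∏ j, g j (x j) = g i (x i) * ∏ j ∈ Finset.univ.erase i, g j (x j) :=
    fun g => (Finset.mul_prod_erase _ _ (Finset.mem_univ i)).symm
  rw [h1 (Function.update _ i _), h1 (fun j => modFn χ (n j) (κ j + (Pi.single i 1 : Fin d → ℕ) j)),
    h1 (fun j => modFn χ (n j) (κ j)), Function.update_self, Pi.single_eq_same]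
  have h2 : ∏ j ∈ Finset.univ.erase i, modFn χ (n j) (κ j + (Pi.single i 1 : Fin d → ℕ) j) (x j) =
      ∏ j ∈ Finset.univ.erase i, modFn χ (n j) (κ j) (x j) :=
    Finset.prod_congr rfl fun j hj => by
      rw [Pi.single_eq_of_ne (Finset.ne_of_mem_erase hj), add_zero]
  have h3 : ∏ j ∈ Finset.univ.erase i, Function.update (fun j => modFn χ (n j) (κ j)) i
      (fun t => modFn χ (n i) (κ i + 1) t + 2 * π * Complex.I * n i * modFn χ (n i) (κ i) t) j (x j) =
      ∏ j ∈ Finset.univ.erase i, modFn χ (n j) (κ j) (x j) :=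
    Finset.prod_congr rfl fun j hj => by
      rw [Function.update_of_ne (Finset.ne_of_mem_erase hj)]
  rw [h2, h3]
  ring

end BumpFn

/-! ### Convolution -/

/-- The convolution of two functions on `ℝ^d`. -/
def cv (φ ψ : Rd d → ℂ) (x : Rd d) : ℂ := ∫ y, φ y * ψ (x - y)

lemma cv_comm (φ ψ : Rd d → ℂ) : cv φ ψ = cv ψ φ := by
  funext x
  rw [cv, cv, ← integral_sub_left_eq_self _ volume x]
  refine integral_congr_ae (Filter.Eventually.of_forall fun y => ?_)
  simp [mul_comm]

lemma cv_jet {φ ψ : Rd d → ℂ} (hφ : Continuous φ) (hψ : ContDiff ℝ (⊤ : ℕ∞) ψ)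
    (hψc : HasCompactSupport ψ) :
    ContDiff ℝ (⊤ : ℕ∞) (cv φ ψ) ∧ ∀ α, mderiv α (cv φ ψ) = cv φ (mderiv α ψ) := by
  have := jet_criterion (F := fun α => cv φ (mderiv α ψ)) fun α x => by
    have hc := hasCompactSupport_mderiv hψ hψc α
    have hd := contDiff_mderiv hψ α
    have h := hc.hasFDerivAt_convolution_right (ContinuousLinearMap.mul ℝ ℂ) (μ := volume)
      hφ.locallyIntegrable (hd.of_le (by exact_mod_cast le_top)) x
    refine h.congr_fderiv (ContinuousLinearMap.coe_injective
      ((EuclideanSpace.basisFun (Fin d) ℝ).toBasis.ext fun i => ?_))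
    have h1 := convolution_precompR_apply (L := ContinuousLinearMap.mul ℝ ℂ) (μ := volume)
      hφ.locallyIntegrable (hc.fderiv ℝ) (hd.continuous_fderiv (by simp)) x
      (EuclideanSpace.single i (1 : ℝ))
    simp only [OrthonormalBasis.coe_toBasis, EuclideanSpace.basisFun_apply,
      ContinuousLinearMap.coe_coe, jetD_single]
    rw [h1, mderiv_add_single hψ]
    rfl
  simpa [mderiv_zero] using this

lemma integrable_cv {φ ψ : Rd d → ℂ} (hφ : Continuous φ) (hφc : HasCompactSupport φ)
    (hψ : Continuous ψ) (x : Rd d) : Integrable fun y => φ y * ψ (x - y) :=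
  (hφ.mul (hψ.comp (continuous_const.sub continuous_id))).integrable_of_hasCompactSupport
    hφc.mul_right

lemma cv_add_right {φ ψ ψ' : Rd d → ℂ} (hφ : Continuous φ) (hφc : HasCompactSupport φ)
    (hψ : Continuous ψ) (hψ' : Continuous ψ') : cv φ (ψ + ψ') = cv φ ψ + cv φ ψ' := by
  funext x
  simp only [cv, Pi.add_apply, mul_add]
  exact integral_add (integrable_cv hφ hφc hψ x) (integrable_cv hφ hφc hψ' x)

lemma cv_smul_right (φ ψ : Rd d → ℂ) (c : ℂ) : cv φ (c • ψ) = c • cv φ ψ := by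
  funext x
  simp only [cv, Pi.smul_apply, smul_eq_mul, mul_left_comm _ c]
  exact integral_const_mul _ _

lemma tsupport_cv_subset {φ ψ : Rd d → ℂ} (hφ : HasCompactSupport φ) (hψ : HasCompactSupport ψ) :
    tsupport (cv φ ψ) ⊆ tsupport ψ + tsupport φ := by
  refine closure_minimal ?_ (hψ.isCompact.add hφ.isCompact).isClosed
  refine (support_convolution_subset (ContinuousLinearMap.mul ℝ ℂ)).trans ?_
  rw [add_comm]
  exact Set.add_subset_add (subset_tsupport _) (subset_tsupport _)

lemma hasCompactSupport_cv {φ ψ : Rd d → ℂ} (hφ : HasCompactSupport φ)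
    (hψ : HasCompactSupport ψ) : HasCompactSupport (cv φ ψ) :=
  (hψ.isCompact.add hφ.isCompact).of_isClosed_subset (isClosed_tsupport _)
    (tsupport_cv_subset hφ hψ)

lemma EBound.cv {M : ℕ → ℝ} {ℓ B : ℝ} {φ ψ : Rd d → ℂ} (hφ : Continuous φ)
    (hφc : HasCompactSupport φ) (hψ : ContDiff ℝ (⊤ : ℕ∞) ψ) (hψc : HasCompactSupport ψ)
    (h : EBound M ℓ B ψ) : EBound M ℓ ((∫ y, ‖φ y‖) * B) (cv φ ψ) := fun α x => by
  rw [(cv_jet hφ hψ hψc).2 α, _root_.cv, mul_assoc, ← integral_mul_const]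
  refine norm_integral_le_of_norm_le ?_ (Filter.Eventually.of_forall fun y => ?_)
  · exact (hφ.integrable_of_hasCompactSupport hφc).norm.mul_const _
  · rw [norm_mul]
    exact mul_le_mul_of_nonneg_left (h α _) (norm_nonneg _)

lemma IsTestD.cv {M : ℕ → ℝ} (hM1 : IsM1 M) {φ ψ : Rd d → ℂ} (hφ : Continuous φ)
    (hφc : HasCompactSupport φ) (hψ : IsTestD M ψ) : IsTestD M (cv φ ψ) := by
  rw [isTestD_iff hM1] at hψ ⊢
  obtain ⟨h1, h2, h3⟩ := hψ
  refine ⟨(cv_jet hφ h1 h2).1, hasCompactSupport_cv hφc h2, fun ℓ hℓ => ?_⟩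
  obtain ⟨B, hB⟩ := h3 ℓ hℓ
  exact ⟨_, hB.cv hφ hφc h1 h2⟩

/-- A binomial expansion for eigenvectors of the difference of two shifts. -/
lemma pow_smul_eq_sum_of_shift {V : Type*} [AddCommGroup V] [Module ℂ V] {I : ℕ → ℕ → V} {c : ℂ}
    (h : ∀ k q, c • I k q = I k (q + 1) - I (k + 1) q) (p : ℕ) :
    c ^ p • I 0 0 = ∑ m ∈ Finset.range (p + 1), ((-1) ^ m * (p.choose m : ℂ)) • I m (p - m) := by
  let X : Module.End ℂ (ℕ → ℕ → V) :=
    { toFun := fun J k q => -J (k + 1) q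
      map_add' := fun J J' => by funext k q; simp [add_comm]
      map_smul' := fun z J => by funext k q; simp }
  let Y : Module.End ℂ (ℕ → ℕ → V) :=
    { toFun := fun J k q => J k (q + 1)
      map_add' := fun J J' => rfl
      map_smul' := fun z J => rfl }
  have hc : Commute X Y := rfl
  have hX : ∀ m (J : ℕ → ℕ → V) k q, (X ^ m) J k q = (-1 : ℂ) ^ m • J (k + m) q := by
    intro m
    induction m with
    | zero => intro J k q; simp
    | succ m ih =>
      intro J k q
      rw [pow_succ', Module.End.mul_apply]
      change -((X ^ m) J (k + 1) q) = _
      rw [ih, pow_succ, show k + 1 + m = k + (m + 1) by ring]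
      simp
  have hY : ∀ m (J : ℕ → ℕ → V) k q, (Y ^ m) J k q = J k (q + m) := by
    intro m
    induction m with
    | zero => intro J k q; simp
    | succ m ih =>
      intro J k q
      rw [pow_succ', Module.End.mul_apply]
      change (Y ^ m) J k (q + 1) = _
      rw [ih, show q + 1 + m = q + (m + 1) by ring]
  have hI : (X + Y) I = c • I := by
    funext k q
    change -I (k + 1) q + I k (q + 1) = c • I k q
    rw [h]
    abel
  have hp : ((X + Y) ^ p) I = c ^ p • I := by
    induction p with
    | zero => simp
    | succ p ih => rw [pow_succ', Module.End.mul_apply, ih, map_smul, hI, smul_smul, pow_succ]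
  have := congrFun (congrFun hp 0) 0
  rw [Pi.smul_apply, Pi.smul_apply, hc.add_pow, LinearMap.sum_apply, Finset.sum_apply,
    Finset.sum_apply] at this
  rw [← this]
  refine Finset.sum_congr rfl fun m _ => ?_
  rw [Module.End.mul_apply, Module.End.mul_apply]
  have h1 : ((p.choose m : ℕ) : Module.End ℂ (ℕ → ℕ → V)) I = (p.choose m : ℂ) • I := by
    rw [Module.End.natCast_apply, Nat.cast_smul_eq_nsmul]
  rw [h1, map_smul, map_smul, Pi.smul_apply, Pi.smul_apply, hX, hY, zero_add, zero_add, smul_smul,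
    mul_comm]

lemma cv_bumpFn_expansion {χ : ℝ → ℂ} (hχ : ContDiff ℝ (⊤ : ℕ∞) χ)
    (h0 : ∀ x, 3 / 8 ≤ |x| → χ x = 0) {φ : Rd d → ℂ} (hφ : ContDiff ℝ (⊤ : ℕ∞) φ)
    (hφc : HasCompactSupport φ) (n : Fin d → ℤ) (i : Fin d) (p : ℕ) :
    (2 * π * Complex.I * n i : ℂ) ^ p • cv φ (bumpFn χ n 0) =
      ∑ m ∈ Finset.range (p + 1), ((-1) ^ m * (p.choose m : ℂ)) •
        cv (mderiv (Pi.single i (p - m)) φ) (bumpFn χ n (Pi.single i m)) := by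
  have hsupp : ∀ κ, HasCompactSupport (bumpFn χ n κ) := fun κ =>
    (isCompact_closedBall (0 : Rd d) d).of_isClosed_subset (isClosed_tsupport _)
      (tsupport_bumpFn_subset h0 n κ)
  have key := pow_smul_eq_sum_of_shift (I := fun k q =>
    cv (mderiv (Pi.single i q) φ) (bumpFn χ n (Pi.single i k))) (c := 2 * π * Complex.I * n i)
    (fun k q => ?_) p
  · simpa [mderiv_zero] using key
  · have hd := contDiff_mderiv hφ (Pi.single i q)
    have hc := hasCompactSupport_mderiv hφ hφc (Pi.single i q)
    have hb := contDiff_bumpFn hχ n (Pi.single i k)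
    have e1 : cv (mderiv (Pi.single i (q + 1)) φ) (bumpFn χ n (Pi.single i k)) =
        cv (mderiv (Pi.single i q) φ) (pder i (bumpFn χ n (Pi.single i k))) := by
      have a1 := (cv_jet hd.continuous hb (hsupp _)).2 (Pi.single i 1)
      rw [mderiv_single hb, Function.iterate_one, cv_comm,
        (cv_jet hb.continuous hd hc).2] at a1
      rw [← a1, cv_comm, Pi.single_add, add_comm, mderiv_add hφ]
    rw [e1, pder_bumpFn hχ, ← Pi.single_add, cv_add_right hd.continuous hc
      (contDiff_bumpFn hχ _ _).continuous (hb.continuous.const_smul _), cv_smul_right,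
      add_sub_cancel_left]

/-! ### Fourier series of functions supported in the unit cube -/

/-- The representative of a point of the torus in the cube `(-1/2, 1/2]^d`. -/
def cubeRep (t : UnitAddTorus (Fin d)) (j : Fin d) : ℝ :=
  (AddCircle.equivIoc 1 (-1 / 2 : ℝ) (t j) : ℝ)

lemma cubeRep_coe {x : Fin d → ℝ} (hx : ∀ j, x j ∈ Set.Ioc (-1 / 2 : ℝ) (-1 / 2 + 1)) :
    cubeRep (fun j => (x j : UnitAddCircle)) = x := by
  funext j
  rw [cubeRep, AddCircle.equivIoc_coe_eq (hx j)]

lemma abs_cubeRep (t : UnitAddTorus (Fin d)) (j : Fin d) : |cubeRep t j| = ‖t j‖ := by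
  have h1 : ((cubeRep t j : ℝ) : UnitAddCircle) = t j := AddCircle.coe_equivIoc
  have h2 := (AddCircle.equivIoc 1 (-1 / 2 : ℝ) (t j)).2
  rw [← h1]
  refine ((AddCircle.norm_coe_eq_abs_iff 1 one_ne_zero).2 ?_).symm
  rw [abs_one, abs_le]
  exact ⟨by have := h2.1.le; unfold cubeRep; linarith, by have := h2.2; unfold cubeRep; linarith⟩

lemma continuous_comp_cubeRep {G : (Fin d → ℝ) → ℂ} (hG : Continuous G)
    (h0 : ∀ x j, 3 / 8 < |x j| → G x = 0) : Continuous fun t => G (cubeRep t) := by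
  rw [continuous_iff_continuousAt]
  intro t
  by_cases ht : ∃ j, 3 / 8 < ‖t j‖
  · obtain ⟨j, hj⟩ := ht
    have hev : (fun _ => (0 : ℂ)) =ᶠ[nhds t] fun t => G (cubeRep t) := by
      have ho : IsOpen {t : UnitAddTorus (Fin d) | 3 / 8 < ‖t j‖} :=
        isOpen_lt continuous_const (continuous_apply j).norm
      filter_upwards [ho.mem_nhds hj] with s hs
      exact (h0 _ j (by rw [abs_cubeRep]; exact hs)).symm
    exact continuousAt_const.congr hev
  · push Not at ht
    refine hG.continuousAt.comp (continuousAt_pi.2 fun j => ?_)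
    have hne : t j ≠ ((-1 / 2 : ℝ) : UnitAddCircle) := by
      intro h
      have h1 := ht j
      rw [h, (AddCircle.norm_coe_eq_abs_iff 1 one_ne_zero).2 (by rw [abs_le]; norm_num)] at h1
      norm_num [abs_le] at h1
    have hj : ContinuousAt (fun t : UnitAddTorus (Fin d) => t j) t :=
      (continuous_apply j).continuousAt
    have hv : ContinuousAt (fun s : UnitAddCircle => (AddCircle.equivIoc 1 (-1 / 2 : ℝ) s : ℝ))
        (t j) :=
      continuousAt_subtype_val.comp (AddCircle.continuousAt_equivIoc 1 _ hne)
    exact ContinuousAt.comp (f := fun t : UnitAddTorus (Fin d) => t j) hv hj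

lemma hasSum_fourier_cube {G : (Fin d → ℝ) → ℂ} (hG : Continuous G)
    (h0 : ∀ x j, 3 / 8 < |x j| → G x = 0)
    (hs : Summable fun n : Fin d → ℤ => ∫ x : Fin d → ℝ,
      (∏ j, Complex.exp (2 * π * Complex.I * n j * x j)) * G x) :
    HasSum (fun n : Fin d → ℤ => ∫ x : Fin d → ℝ,
      (∏ j, Complex.exp (2 * π * Complex.I * n j * x j)) * G x) (G 0) := by
  let g : C(UnitAddTorus (Fin d), ℂ) := ⟨fun t => G (cubeRep t), continuous_comp_cubeRep hG h0⟩
  have hc : ∀ n : Fin d → ℤ, UnitAddTorus.mFourierCoeff g (-n) = ∫ x : Fin d → ℝ,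
      (∏ j, Complex.exp (2 * π * Complex.I * n j * x j)) * G x := by
    intro n
    rw [UnitAddTorus.mFourierCoeff_eq_integral g (-n) fun _ => -1 / 2]
    have hmeas : MeasurableSet {x : Fin d → ℝ | ∀ i, x i ∈ Set.Ioc (-1 / 2 : ℝ) (-1 / 2 + 1)} := by
      simp only [Set.ofPred_forall]
      exact MeasurableSet.iInter fun i => measurable_pi_apply i measurableSet_Ioc
    refine Eq.trans ?_ (setIntegral_eq_integral_of_forall_compl_eq_zero
      (s := {x : Fin d → ℝ | ∀ i, x i ∈ Set.Ioc (-1 / 2 : ℝ) (-1 / 2 + 1)}) ?_)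
    · refine setIntegral_congr_fun hmeas fun x hx => ?_
      have h1 : g (fun j => (x j : UnitAddCircle)) = G x := by
        change G (cubeRep _) = _
        rw [cubeRep_coe hx]
      have h2 : UnitAddTorus.mFourier (- -n) (fun j => (x j : UnitAddCircle)) =
          ∏ j, Complex.exp (2 * π * Complex.I * n j * x j) := by
        rw [neg_neg]
        change ∏ j, fourier (n j) (x j : UnitAddCircle) = _
        refine Finset.prod_congr rfl fun j _ => ?_
        rw [fourier_coe_apply]
        congr 1
        simp
      simp only [h1, h2, smul_eq_mul]
    · intro x hx
      simp only [Set.mem_ofPred_eq, not_forall] at hx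
      obtain ⟨j, hj⟩ := hx
      rw [h0 x j, mul_zero]
      by_contra! h
      rw [abs_le] at h
      exact hj ⟨by linarith, by linarith⟩
  have hs' : Summable (UnitAddTorus.mFourierCoeff g) := by
    rw [← (Equiv.neg (Fin d → ℤ)).summable_iff]
    exact hs.congr fun n => (hc n).symm
  have h := UnitAddTorus.hasSum_mFourier_series_apply_of_summable hs' 0
  rw [← (Equiv.neg (Fin d → ℤ)).hasSum_iff] at h
  have e0 : g 0 = G 0 := by
    change G (cubeRep _) = _
    congr 1
    exact cubeRep_coe (x := 0) fun j => ⟨by norm_num, by norm_num⟩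
  rw [e0] at h
  convert! h using 2 with n
  simp only [Function.comp_apply, Equiv.neg_apply, hc n, smul_eq_mul]
  have h1 : UnitAddTorus.mFourier (-n) (0 : UnitAddTorus (Fin d)) = 1 := by
    change ∏ j, fourier ((-n) j) (0 : UnitAddCircle) = 1
    simp
  rw [h1, mul_one]

/-! ### Expansion of test functions into localized frequencies -/

section TestSpace

variable {M : ℕ → ℝ}

lemma contDiff_smul_fun {f : Rd d → ℂ} (hf : ContDiff ℝ (⊤ : ℕ∞) f) (c : ℂ) :
    ContDiff ℝ (⊤ : ℕ∞) (c • f) :=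
  hf.const_smul c

lemma contDiff_finset_sum {ι : Type*} {u : ι → Rd d → ℂ} (hu : ∀ i, ContDiff ℝ (⊤ : ℕ∞) (u i))
    (s : Finset ι) : ContDiff ℝ (⊤ : ℕ∞) (∑ i ∈ s, u i) := by
  rw [Finset.sum_fn]
  exact ContDiff.sum fun i _ => hu i

lemma isTestD_zero (hM1 : IsM1 M) : IsTestD M (0 : Rd d → ℂ) := by
  refine (isTestD_iff hM1).2 ⟨contDiff_const, HasCompactSupport.zero, fun ℓ hℓ => ⟨0, fun α x => ?_⟩⟩
  have h := mderiv_const_smul (f := (0 : Rd d → ℂ)) contDiff_const 0 α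
  rw [smul_zero, zero_smul] at h
  simp [h]

/-- The space of test functions supported in `K`. -/
def testSpace (hM1 : IsM1 M) (K : Set (Rd d)) : Submodule ℂ (Rd d → ℂ) where
  carrier := {φ | IsTestD M φ ∧ tsupport φ ⊆ K}
  add_mem' := fun {φ ψ} hφ hψ => ⟨hφ.1.add hM1 hψ.1,
    (tsupport_add φ ψ).trans (Set.union_subset hφ.2 hψ.2)⟩
  zero_mem' := ⟨isTestD_zero hM1, by simp⟩
  smul_mem' := fun c φ hφ => ⟨hφ.1.const_smul hM1 c,
    (tsupport_smul_subset_right (fun _ => c) φ).trans hφ.2⟩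

lemma mderiv_sub {f g : Rd d → ℂ} (hf : ContDiff ℝ (⊤ : ℕ∞) f) (hg : ContDiff ℝ (⊤ : ℕ∞) g)
    (α : Fin d → ℕ) : mderiv α (f - g) = mderiv α f - mderiv α g := by
  have h : f - g = f + (-1 : ℂ) • g := by simp [sub_eq_add_neg]
  rw [h, mderiv_fun_add hf (contDiff_smul_fun hg _), mderiv_const_smul hg]
  simp [sub_eq_add_neg]

lemma EBound.sum {ι : Type*} {s : Finset ι} {ℓ : ℝ} {B : ι → ℝ} {φ : ι → Rd d → ℂ}
    (hφ : ∀ i, ContDiff ℝ (⊤ : ℕ∞) (φ i)) (h : ∀ i ∈ s, EBound M ℓ (B i) (φ i)) :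
    EBound M ℓ (∑ i ∈ s, B i) (∑ i ∈ s, φ i) := fun α x => by
  rw [mderiv_sum hφ, Finset.sum_apply, Finset.sum_mul]
  exact norm_sum_le_of_le _ fun i hi => h i hi α x

lemma IsTestD.mderiv (hM1 : IsM1 M) (hM2 : IsM2 M) {φ : Rd d → ℂ} (hφ : IsTestD M φ)
    (β : Fin d → ℕ) : IsTestD M (mderiv β φ) := by
  rw [isTestD_iff hM1] at hφ ⊢
  obtain ⟨h1, h2, h3⟩ := hφ
  refine ⟨contDiff_mderiv h1 β, hasCompactSupport_mderiv h1 h2 β, fun ℓ hℓ => ?_⟩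
  obtain ⟨A, H, hA, hH, h⟩ := hM2
  have hH0 : 0 < H := by linarith
  obtain ⟨B, hB⟩ := h3 (ℓ / H) (by positivity)
  have hB0 := hB.nonneg hM1
  refine ⟨B * A * ℓ ^ mOrd β * M (mOrd β), fun α x => ?_⟩
  rw [← mderiv_add h1]
  refine (hB (α + β) x).trans ?_
  rw [mOrd_add]
  calc B * ((ℓ / H) ^ (mOrd α + mOrd β) * M (mOrd α + mOrd β))
      ≤ B * ((ℓ / H) ^ (mOrd α + mOrd β) *
          (A * H ^ (mOrd α + mOrd β) * M (mOrd α) * M (mOrd β))) := by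
        refine mul_le_mul_of_nonneg_left (mul_le_mul_of_nonneg_left (h _ _) ?_) hB0
        positivity
    _ = _ := by
        rw [div_pow]
        field_simp
        ring

/-- Termwise action of an ultradistribution on a series converging in the test space. -/
lemma IsUltraD.hasSum (hM1 : IsM1 M) {f : (Rd d → ℂ) →ₗ[ℂ] ℂ} (hf : IsUltraD M f)
    {K : Set (Rd d)} (hK : IsCompact K) {ι : Type*} {u : ι → Rd d → ℂ} {w : ι → ℝ}
    (hw : Summable w) (hu : ∀ i, u i ∈ testSpace hM1 K)
    (hb : ∀ ℓ > 0, ∃ B, ∀ i, EBound M ℓ (B * w i) (u i)) {φ : Rd d → ℂ}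
    (hφ : φ ∈ testSpace hM1 K)
    (hs : ∀ α x, HasSum (fun i => mderiv α (u i) x) (mderiv α φ x)) :
    HasSum (fun i => f (u i)) (f φ) := by
  classical
  obtain ⟨ℓ, hℓ, C, hC, hfC⟩ := hf.exists_bound hM1 hK
  obtain ⟨B, hB⟩ := hb ℓ hℓ
  have hBw : Summable fun i => B * w i := hw.mul_left B
  have hBw0 : ∀ i, 0 ≤ B * w i := fun i => (hB i).nonneg hM1
  have hcd : ∀ i, ContDiff ℝ (⊤ : ℕ∞) (u i) := fun i => (hu i).1.1
  have htail : ∀ s : Finset ι, EBound M ℓ (∑' i, B * w i - ∑ i ∈ s, B * w i)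
      (φ - ∑ i ∈ s, u i) := by
    intro s α x
    rw [mderiv_sub hφ.1.1 (contDiff_finset_sum hcd s), mderiv_sum hcd, Pi.sub_apply, Finset.sum_apply]
    have h1 := ((hs α x).sub_const (∑ i ∈ s, mderiv α (u i) x)).norm
    refine le_of_tendsto h1 ?_
    filter_upwards [Filter.eventually_ge_atTop s] with t hst
    rw [← Finset.sum_sdiff hst, add_sub_cancel_right]
    calc _ ≤ ∑ i ∈ t \ s, B * w i * (ℓ ^ mOrd α * M (mOrd α)) :=
          norm_sum_le_of_le _ fun i _ => hB i α x
      _ = (∑ i ∈ t \ s, B * w i) * (ℓ ^ mOrd α * M (mOrd α)) := (Finset.sum_mul _ _ _).symm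
      _ ≤ _ := by
          refine mul_le_mul_of_nonneg_right ?_ (mul_nonneg (pow_nonneg hℓ.le _) (hM1.1 _).le)
          rw [le_sub_iff_add_le, Finset.sum_sdiff hst]
          exact hBw.sum_le_tsum t fun i _ => hBw0 i
  have hlim : Filter.Tendsto (fun s : Finset ι => C * (∑' i, B * w i - ∑ i ∈ s, B * w i))
      Filter.atTop (nhds 0) := by
    have := ((tendsto_const_nhds (x := ∑' i, B * w i)).sub hBw.hasSum).const_mul C
    simpa using this
  rw [HasSum, tendsto_iff_norm_sub_tendsto_zero]
  refine squeeze_zero (fun _ => norm_nonneg _) (fun s => ?_) hlim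
  have hmem : φ - ∑ i ∈ s, u i ∈ testSpace hM1 K :=
    Submodule.sub_mem _ hφ (Submodule.sum_mem _ fun i _ => hu i)
  have := hfC _ _ hmem.1 hmem.2 (htail s)
  rwa [map_sub, map_sum, norm_sub_rev] at this

end TestSpace

section Expansion

variable {M : ℕ → ℝ} {χ : ℝ → ℂ}

lemma norm_bumpFn (n : Fin d → ℤ) (κ : Fin d → ℕ) (x : Rd d) :
    ‖bumpFn χ n κ x‖ = ‖bumpFn χ 0 κ x‖ := by
  have h : ∀ (ν : ℤ) (t : ℝ), ‖Complex.exp (2 * π * Complex.I * ν * t)‖ = 1 := fun ν t => by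
    have e : (2 * π * Complex.I * ν * t : ℂ) = ((2 * π * ν * t : ℝ) : ℂ) * Complex.I := by
      push_cast
      ring
    rw [e, Complex.norm_exp_ofReal_mul_I]
  simp only [bumpFn, tensorFn, modFn, norm_prod, norm_mul, h]

lemma hasCompactSupport_bumpFn (h0 : ∀ x, 3 / 8 ≤ |x| → χ x = 0) (n : Fin d → ℤ)
    (κ : Fin d → ℕ) : HasCompactSupport (bumpFn χ n κ) :=
  (isCompact_closedBall (0 : Rd d) d).of_isClosed_subset (isClosed_tsupport _)
    (tsupport_bumpFn_subset h0 n κ)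

lemma eBound_cv_bumpFn [Nonempty (Fin d)] (hM1 : IsM1 M) (hM2 : IsM2 M)
    (hχ : ContDiff ℝ (⊤ : ℕ∞) χ) (h0 : ∀ x, 3 / 8 ≤ |x| → χ x = 0) {φ : Rd d → ℂ}
    (hφ : IsTestD M φ) {ℓ : ℝ} (hℓ : 0 < ℓ) :
    ∃ B, ∀ n, EBound M ℓ (B * latW n) (cv φ (bumpFn χ n 0)) := by
  have hD : ∀ (i : Fin d) (q m : ℕ), ∃ D, ∀ n, EBound M ℓ D
      (cv (mderiv (Pi.single i q) φ) (bumpFn χ n (Pi.single i m))) := by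
    intro i q m
    have ht := hφ.mderiv hM1 hM2 (Pi.single i q)
    obtain ⟨B, hB⟩ := ((isTestD_iff hM1).1 ht).2.2 ℓ hℓ
    refine ⟨(∫ y, ‖bumpFn χ (0 : Fin d → ℤ) (Pi.single i m) y‖) * B, fun n => ?_⟩
    rw [cv_comm]
    have := hB.cv (contDiff_bumpFn hχ n (Pi.single i m)).continuous
      (hasCompactSupport_bumpFn h0 n _) ht.1 ht.2.1
    simpa only [norm_bumpFn n] using this
  choose D hD using hD
  have hD0 : ∀ i q m, 0 ≤ D i q m := fun i q m => (hD i q m 0).nonneg hM1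
  let S : Fin d → ℕ → ℝ := fun i p => ∑ m ∈ Finset.range (p + 1), (p.choose m : ℝ) * D i (p - m) m
  have hS0 : ∀ i p, 0 ≤ S i p := fun i p =>
    Finset.sum_nonneg fun m _ => mul_nonneg (Nat.cast_nonneg _) (hD0 _ _ _)
  refine ⟨2 ^ d * ∑ i, (S i 0 + S i (2 * d)), fun n => ?_⟩
  obtain ⟨i, hi⟩ := exists_abs_max n
  obtain ⟨p, hp, hc, hpn⟩ : ∃ p, (p = 0 ∨ p = 2 * d) ∧ (2 * π * Complex.I * n i : ℂ) ^ p ≠ 0 ∧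
      ‖((2 * π * Complex.I * n i : ℂ) ^ p)⁻¹‖ ≤ 2 ^ d * latW n := by
    by_cases hn : n i = 0
    · refine ⟨0, Or.inl rfl, by simp, ?_⟩
      have hn0 : n = 0 := by
        funext j
        have := hi j
        rw [hn, abs_zero] at this
        exact abs_nonpos_iff.1 this
      simp [hn0, latW, one_le_pow₀]
    · refine ⟨2 * d, Or.inr rfl, ?_, ?_⟩
      · refine pow_ne_zero _ ?_
        simp [hn, Real.pi_ne_zero]
      · refine le_trans ?_ (inv_pow_le_latW hi hn)
        have h1 : (0 : ℝ) < |(n i : ℝ)| := by positivity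
        have h2 : ‖(2 * π * Complex.I * n i : ℂ)‖ = 2 * π * |(n i : ℝ)| := by
          simp [abs_of_pos Real.pi_pos]
        rw [norm_inv, norm_pow, ← inv_pow, h2, Int.cast_abs]
        refine pow_le_pow_left₀ (by positivity) (inv_anti₀ h1 ?_) _
        have := Real.pi_gt_three
        nlinarith
  have hEx : EBound M ℓ (S i p) ((2 * π * Complex.I * n i : ℂ) ^ p • cv φ (bumpFn χ n 0)) := by
    rw [cv_bumpFn_expansion hχ h0 hφ.1 hφ.2.1]
    have hcd : ∀ m, ContDiff ℝ (⊤ : ℕ∞)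
        (cv (mderiv (Pi.single i (p - m)) φ) (bumpFn χ n (Pi.single i m))) := fun m =>
      (cv_jet (contDiff_mderiv hφ.1 _).continuous (contDiff_bumpFn hχ n _)
        (hasCompactSupport_bumpFn h0 n _)).1
    refine EBound.sum (fun m => contDiff_smul_fun (hcd m) _) fun m _ => ?_
    convert! (hD i (p - m) m n).const_smul (hcd m) ((-1) ^ m * (p.choose m : ℂ)) using 1
    simp
  have hcd := (cv_jet hφ.1.continuous (contDiff_bumpFn hχ n 0) (hasCompactSupport_bumpFn h0 n 0)).1
  have h1 := hEx.const_smul (contDiff_smul_fun hcd _) ((2 * π * Complex.I * n i : ℂ) ^ p)⁻¹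
  rw [inv_smul_smul₀ hc] at h1
  refine h1.mono hM1 hℓ ?_
  have hle : S i p ≤ ∑ i, (S i 0 + S i (2 * d)) := by
    refine le_trans ?_ (Finset.single_le_sum (f := fun i => S i 0 + S i (2 * d))
      (fun j _ => add_nonneg (hS0 _ _) (hS0 _ _)) (Finset.mem_univ i))
    rcases hp with rfl | rfl
    · exact le_add_of_nonneg_right (hS0 _ _)
    · exact le_add_of_nonneg_left (hS0 _ _)
  calc _ ≤ 2 ^ d * latW n * ∑ i, (S i 0 + S i (2 * d)) :=
        mul_le_mul hpn hle (hS0 _ _) (by have := latW_pos n; positivity)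
    _ = _ := by ring

lemma hasSum_cv_bumpFn [Nonempty (Fin d)] (hM1 : IsM1 M) (hM2 : IsM2 M)
    (hχ : ContDiff ℝ (⊤ : ℕ∞) χ) (h1 : χ 0 = 1) (h0 : ∀ x, 3 / 8 ≤ |x| → χ x = 0) {φ : Rd d → ℂ}
    (hφ : IsTestD M φ) (x : Rd d) : HasSum (fun n => cv φ (bumpFn χ n 0) x) (φ x) := by
  have hsum : Summable fun n => cv φ (bumpFn χ n 0) x := by
    obtain ⟨B, hB⟩ := eBound_cv_bumpFn hM1 hM2 hχ h0 hφ one_pos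
    refine Summable.of_norm_bounded ((summable_latW.mul_left B).mul_right (1 ^ 0 * M 0)) fun n => ?_
    have := hB n 0 x
    rwa [mderiv_zero, mOrd_zero] at this
  let G : (Fin d → ℝ) → ℂ := fun y => (∏ j, χ (y j)) * φ (x - WithLp.toLp 2 y)
  have hG : Continuous G := by
    have := hχ.continuous
    have := hφ.1.continuous
    have := PiLp.continuous_toLp 2 (fun _ : Fin d => ℝ)
    fun_prop
  have hG0 : ∀ y j, 3 / 8 < |y j| → G y = 0 := fun y j hj => by
    have : ∏ j, χ (y j) = 0 := Finset.prod_eq_zero (Finset.mem_univ j) (h0 _ hj.le)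
    simp [G, this]
  have h_int : ∀ n : Fin d → ℤ, cv φ (bumpFn χ n 0) x = ∫ y : Fin d → ℝ,
      (∏ j, Complex.exp (2 * π * Complex.I * n j * y j)) * G y := by
    intro n
    rw [cv_comm, cv, ← (PiLp.volume_preserving_toLp (Fin d)).integral_comp
      (MeasurableEquiv.toLp 2 (Fin d → ℝ)).measurableEmbedding]
    refine integral_congr_ae (Filter.Eventually.of_forall fun y => ?_)
    simp only [bumpFn, tensorFn, modFn, Pi.zero_apply, iteratedDeriv_zero, G,
      Finset.prod_mul_distrib]
    ring
  have h := hasSum_fourier_cube hG hG0 (by simpa only [← h_int] using hsum)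
  simp only [← h_int] at h
  convert! h using 1
  simp [G, h1]

lemma hasSum_apply_cv_bumpFn [Nonempty (Fin d)] (hM1 : IsM1 M) (hM2 : IsM2 M) (hM3 : IsM3' M)
    (hχ : ContDiff ℝ (⊤ : ℕ∞) χ) (h1 : χ 0 = 1) (h0 : ∀ x, 3 / 8 ≤ |x| → χ x = 0)
    (hb : ∀ h > 0, ∃ C > 0, ∀ k x, ‖iteratedDeriv k χ x‖ ≤ C * (h ^ k * M k))
    {f : (Rd d → ℂ) →ₗ[ℂ] ℂ} (hf : IsUltraD M f) {φ : Rd d → ℂ} (hφ : IsTestD M φ) :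
    HasSum (fun n => f (cv φ (bumpFn χ n 0))) (f φ) := by
  have hmem : ∀ n, cv φ (bumpFn χ n 0) ∈
      testSpace hM1 (Metric.closedBall (0 : Rd d) d + tsupport φ) := fun n =>
    ⟨(isTestD_bumpFn hM1 hM2 hM3 hχ h0 hb n 0).cv hM1 hφ.1.continuous hφ.2.1,
      (tsupport_cv_subset hφ.2.1 (hasCompactSupport_bumpFn h0 n 0)).trans
        (Set.add_subset_add_right (tsupport_bumpFn_subset h0 n 0))⟩
  refine hf.hasSum hM1 ((isCompact_closedBall (0 : Rd d) d).add hφ.2.1.isCompact) summable_latW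
    hmem (fun ℓ hℓ => eBound_cv_bumpFn hM1 hM2 hχ h0 hφ hℓ) ⟨hφ, fun x hx =>
      ⟨0, by simp, x, hx, zero_add x⟩⟩ fun α x => ?_
  convert! hasSum_cv_bumpFn hM1 hM2 hχ h1 h0 (hφ.mderiv hM1 hM2 α) x using 2 with n
  rw [cv_comm, (cv_jet (contDiff_bumpFn hχ n 0).continuous hφ.1 hφ.2.1).2, cv_comm]

end Expansion

/-! ### Uniform boundedness on the test space -/

section UniformBound

variable {M : ℕ → ℝ}

/-- Series in the test space converge. -/
lemma exists_hasSum_mderiv (hM1 : IsM1 M) {K : Set (Rd d)} (hK : IsCompact K) {ι : Type*}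
    {u : ι → Rd d → ℂ} {w : ι → ℝ} (hw : Summable w) (hu : ∀ i, u i ∈ testSpace hM1 K)
    (hb : ∀ ℓ > 0, ∃ B, ∀ i, EBound M ℓ (B * w i) (u i)) :
    ∃ φ ∈ testSpace hM1 K, ∀ α x, HasSum (fun i => mderiv α (u i) x) (mderiv α φ x) := by
  have hcd : ∀ i, ContDiff ℝ (⊤ : ℕ∞) (u i) := fun i => (hu i).1.1
  have hs : ∀ α x, Summable fun i => mderiv α (u i) x := by
    intro α x
    obtain ⟨B, hB⟩ := hb 1 one_pos
    exact Summable.of_norm_bounded ((hw.mul_left B).mul_right _) fun i => hB i α x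
  let F : (Fin d → ℕ) → Rd d → ℂ := fun α x => ∑' i, mderiv α (u i) x
  have hF : ∀ α x, HasFDerivAt (F α) (jetD fun j => F (α + Pi.single j 1) x) x := by
    intro α x
    obtain ⟨B, hB⟩ := hb 1 one_pos
    have hB' : ∀ j i y, ‖mderiv (α + Pi.single j 1) (u i) y‖ ≤
        B * w i * (1 ^ (mOrd α + 1) * M (mOrd α + 1)) := fun j i y => by
      have := hB i (α + Pi.single j 1) y
      rwa [mOrd_add, mOrd_single] at this
    have h := hasFDerivAt_tsum (𝕜 := ℝ) (f := fun i => mderiv α (u i))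
      (f' := fun i x => jetD fun j => mderiv (α + Pi.single j 1) (u i) x)
      (u := fun i => ∑ _j : Fin d, B * w i * (1 ^ (mOrd α + 1) * M (mOrd α + 1)))
      (x₀ := x) (summable_sum fun j _ => (hw.mul_left B).mul_right _)
      (fun i y => hasFDerivAt_mderiv (hcd i) α y) (fun i y => (norm_jetD_le _).trans
        (Finset.sum_le_sum fun j _ => hB' j i y))
      (hs α x) x
    convert! h using 1
    refine ((EuclideanSpace.basisFun (Fin d) ℝ).toBasis.ext fun j => ?_) |> fun e =>
      ContinuousLinearMap.coe_injective e
    have hsum : Summable fun i => (jetD fun j => mderiv (α + Pi.single j 1) (u i) x :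
        Rd d →L[ℝ] ℂ) := by
      refine Summable.of_norm_bounded
        (g := fun i => ∑ _j : Fin d, B * w i * (1 ^ (mOrd α + 1) * M (mOrd α + 1)))
        (summable_sum fun j _ => (hw.mul_left B).mul_right _) fun i => (norm_jetD_le _).trans
        (Finset.sum_le_sum fun j _ => hB' j i x)
    simp only [OrthonormalBasis.coe_toBasis, EuclideanSpace.basisFun_apply,
      ContinuousLinearMap.coe_coe, jetD_single]
    have h := hsum.hasSum.mapL
      (ContinuousLinearMap.apply ℝ ℂ (EuclideanSpace.single j (1 : ℝ) : Rd d))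
    simp only [ContinuousLinearMap.apply_apply, jetD_single] at h
    exact h.tsum_eq
  obtain ⟨h1, h2⟩ := jet_criterion hF
  have hsupp : tsupport (F 0) ⊆ K := by
    refine closure_minimal (fun x hx => ?_) hK.isClosed
    by_contra hxK
    refine hx ?_
    have : ∀ i, u i x = 0 := fun i => image_eq_zero_of_notMem_tsupport fun h => hxK ((hu i).2 h)
    simp [F, mderiv_zero, this]
  refine ⟨F 0, ⟨(isTestD_iff hM1).2 ⟨h1, hK.of_isClosed_subset (isClosed_tsupport _) hsupp,
    fun ℓ hℓ => ?_⟩, hsupp⟩, fun α x => by rw [h2]; exact (hs α x).hasSum⟩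
  obtain ⟨B, hB⟩ := hb ℓ hℓ
  refine ⟨∑' i, B * w i, fun α x => ?_⟩
  rw [h2, ← tsum_mul_right]
  exact tsum_of_norm_bounded ((hw.mul_left B).mul_right _).hasSum fun i => hB i α x

lemma testSpace_translate {hM1 : IsM1 M} {K : Set (Rd d)} {φ : Rd d → ℂ}
    (hφ : φ ∈ testSpace hM1 K) {S : Set (Rd d)} {y : Rd d} (hy : y ∈ S) :
    (fun x => φ (x - y)) ∈ testSpace hM1 (K + S) := by
  refine ⟨hφ.1.translate hM1 y, fun x hx => ?_⟩
  rw [tsupport_translate] at hx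
  exact ⟨x - y, hφ.2 hx, y, hy, sub_add_cancel x y⟩

lemma summable_mul_of_mem_lp_top (a : lp (fun _ : ℕ => ℂ) ⊤) {c : ℕ → ℂ}
    (hc : Summable fun k => ‖c k‖) : Summable fun k => a k * c k := by
  refine Summable.of_norm_bounded (hc.mul_left ‖a‖) fun k => ?_
  rw [norm_mul]
  exact mul_le_mul_of_nonneg_right (lp.norm_apply_le_norm (by simp) a k) (norm_nonneg _)

/-- The pairing of bounded sequences with a summable sequence. -/
def pairing (c : ℕ → ℂ) (hc : Summable fun k => ‖c k‖) : lp (fun _ : ℕ => ℂ) ⊤ →L[ℂ] ℂ :=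
  LinearMap.mkContinuous
    { toFun := fun a => ∑' k, a k * c k
      map_add' := fun a b => by
        rw [← (summable_mul_of_mem_lp_top a hc).tsum_add (summable_mul_of_mem_lp_top b hc)]
        simp [add_mul]
      map_smul' := fun r a => by
        simp [mul_assoc, tsum_mul_left] }
    (∑' k, ‖c k‖) fun a => by
      rw [mul_comm, ← tsum_mul_left]
      refine tsum_of_norm_bounded (hc.mul_left ‖a‖).hasSum fun k => ?_
      rw [norm_mul]
      exact mul_le_mul_of_nonneg_right (lp.norm_apply_le_norm (by simp) a k) (norm_nonneg _)

lemma pairing_apply (c : ℕ → ℂ) (hc : Summable fun k => ‖c k‖) (a : lp (fun _ : ℕ => ℂ) ⊤) :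
    pairing c hc a = ∑' k, a k * c k := rfl

/-- Translation bounds that hold for every test function hold uniformly on bounded sequences of
test functions. -/
lemma exists_bound_of_sequence (hM1 : IsM1 M) {f : (Rd d → ℂ) →ₗ[ℂ] ℂ} (hf : IsUltraD M f)
    {W : Set (Rd d)} {ω : Rd d → ℝ} (hω : ∀ x ∈ W, 0 < ω x)
    (hb : ∀ φ : Rd d → ℂ, IsTestD M φ →
      ∃ C : ℝ, ∀ h ∈ W, ‖f (fun x => φ (x - h))‖ ≤ C * ω h)
    {K : Set (Rd d)} (hK : IsCompact K) {u : ℕ → Rd d → ℂ} (hu : ∀ k, u k ∈ testSpace hM1 K)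
    {w : ℕ → ℝ} (hw : Summable w) (hB : ∀ ℓ > 0, ∃ B, ∀ k, EBound M ℓ (B * w k) (u k)) :
    ∃ C, ∀ h ∈ W, ∀ k, ‖f fun x => u k (x - h)‖ ≤ C * ω h := by
  have hcd : ∀ k, ContDiff ℝ (⊤ : ℕ∞) (u k) := fun k => (hu k).1.1
  have hc : ∀ h, Summable fun k => ‖((ω h)⁻¹ : ℂ) * f fun x => u k (x - h)‖ := by
    intro h
    obtain ⟨ℓ, hℓ, C, hC, hfC⟩ := hf.exists_bound hM1 (hK.add (isCompact_singleton (x := h)))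
    obtain ⟨B, hB⟩ := hB ℓ hℓ
    simp only [norm_mul]
    refine Summable.mul_left _ (Summable.of_norm_bounded ((hw.mul_left B).mul_left C) fun k => ?_)
    have := testSpace_translate (hu k) (Set.mem_singleton h)
    rw [norm_norm]
    exact hfC _ _ this.1 this.2 ((hB k).translate (hcd k) h)
  obtain ⟨C, hC⟩ := banach_steinhaus (g := fun h : W => pairing _ (hc h)) fun a => by
    have hua : ∀ k, a k • u k ∈ testSpace hM1 K := fun k => Submodule.smul_mem _ _ (hu k)
    have hBa : ∀ ℓ > 0, ∃ B, ∀ k, EBound M ℓ (B * w k) (a k • u k) := by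
      intro ℓ hℓ
      obtain ⟨B, hB⟩ := hB ℓ hℓ
      refine ⟨‖a‖ * B, fun k => ((hB k).const_smul (hcd k) (a k)).mono hM1 hℓ ?_⟩
      rw [mul_assoc]
      exact mul_le_mul_of_nonneg_right (lp.norm_apply_le_norm (by simp) a k) ((hB k).nonneg hM1)
    obtain ⟨φ, hφ, hsum⟩ := exists_hasSum_mderiv hM1 hK hw hua hBa
    obtain ⟨C, hC⟩ := hb φ hφ.1
    refine ⟨C, fun h => ?_⟩
    have h1 : HasSum (fun k => f fun x => (a k • u k) (x - h)) (f fun x => φ (x - h)) := by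
      refine hf.hasSum hM1 (hK.add (isCompact_singleton (x := (h : Rd d)))) hw
        (fun k => testSpace_translate (hua k) (Set.mem_singleton (h : Rd d))) (fun ℓ hℓ => ?_)
        (testSpace_translate hφ (Set.mem_singleton (h : Rd d))) fun α x => ?_
      · obtain ⟨B, hB⟩ := hBa ℓ hℓ
        exact ⟨B, fun k => (hB k).translate (hua k).1.1 h⟩
      · simp only [mderiv_translate hφ.1.1, fun k => mderiv_translate (hua k).1.1 h α]
        exact hsum α (x - h)
    have h2 : pairing _ (hc h) a = ((ω h)⁻¹ : ℂ) * f fun x => φ (x - h) := by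
      rw [pairing_apply, ← h1.tsum_eq, ← tsum_mul_left]
      refine tsum_congr fun k => ?_
      have : (fun x => (a k • u k) (x - h)) = a k • fun x => u k (x - h) := rfl
      rw [this, map_smul, smul_eq_mul]
      ring
    rw [h2, norm_mul, norm_inv, Complex.norm_real, Real.norm_of_nonneg (hω h h.2).le,
      inv_mul_le_iff₀ (hω h h.2), mul_comm]
    exact hC h h.2
  refine ⟨C, fun h hh k => ?_⟩
  have h1 := (pairing _ (hc h)).le_of_opNorm_le (hC ⟨h, hh⟩) (lp.single ⊤ k (1 : ℂ))
  have h2 : pairing _ (hc h) (lp.single ⊤ k (1 : ℂ)) = ((ω h)⁻¹ : ℂ) * f fun x => u k (x - h) := by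
    rw [pairing_apply, tsum_eq_single k fun j hj => by simp [lp.single_apply, hj]]
    simp
  rw [h2, lp.norm_single (by simp), norm_one, mul_one, norm_mul, norm_inv, Complex.norm_real,
    Real.norm_of_nonneg (hω h hh).le, inv_mul_le_iff₀ (hω h hh), mul_comm] at h1
  exact h1

/-- Translation bounds that hold for every test function hold uniformly. -/
lemma exists_uniform_translation_bound (hM1 : IsM1 M) {f : (Rd d → ℂ) →ₗ[ℂ] ℂ}
    (hf : IsUltraD M f) {W : Set (Rd d)} {ω : Rd d → ℝ} (hω : ∀ x ∈ W, 0 < ω x)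
    (hb : ∀ φ : Rd d → ℂ, IsTestD M φ →
      ∃ C : ℝ, ∀ h ∈ W, ‖f (fun x => φ (x - h))‖ ≤ C * ω h)
    {K : Set (Rd d)} (hK : IsCompact K) :
    ∃ ℓ > 0, ∃ C > 0, ∀ h ∈ W, ∀ ψ B, ψ ∈ testSpace hM1 K → EBound M ℓ B ψ →
      ‖f fun x => ψ (x - h)‖ ≤ C * B * ω h := by
  by_contra! hcon
  choose h hh ψ B hψ hE hlt using fun k : ℕ =>
    hcon (1 / (k + 1)) (by positivity) ((k + 1) * 2 ^ k) (by positivity)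
  have hB : ∀ k, 0 < B k := by
    intro k
    refine ((hE k).nonneg hM1).lt_of_ne' fun h0 => ?_
    have h1 : (fun x => ψ k (x - h k)) = 0 := by
      funext x
      have := hE k 0 (x - h k)
      rw [h0, zero_mul, mderiv_zero] at this
      simpa using this
    have := hlt k
    rw [h1, h0, map_zero] at this
    simp at this
  let c : ℕ → ℂ := fun k => (((1 / 2) ^ k / B k : ℝ) : ℂ)
  have hc : ∀ k, ‖c k‖ = (1 / 2) ^ k / B k := fun k => by
    have := hB k
    rw [Complex.norm_real, Real.norm_of_nonneg (by positivity)]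
  have hu : ∀ k, c k • ψ k ∈ testSpace hM1 K := fun k => Submodule.smul_mem _ _ (hψ k)
  obtain ⟨C, hC⟩ := exists_bound_of_sequence hM1 hf hω hb hK hu summable_geometric_two
    fun ℓ hℓ => by
      choose D hD using fun k => ((isTestD_iff hM1).1 (hu k).1).2.2 ℓ hℓ
      have hD0 : ∀ k, 0 ≤ D k := fun k => (hD k).nonneg hM1
      obtain ⟨N, hN⟩ := exists_nat_one_div_lt hℓ
      refine ⟨1 + ∑ k ∈ Finset.range N, 2 ^ k * D k, fun k => ?_⟩
      have hS : 0 ≤ ∑ k ∈ Finset.range N, 2 ^ k * D k :=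
        Finset.sum_nonneg fun k _ => mul_nonneg (by positivity) (hD0 k)
      rcases lt_or_ge k N with hk | hk
      · refine (hD k).mono hM1 hℓ ?_
        have h1 := Finset.single_le_sum (f := fun k => 2 ^ k * D k)
          (fun k _ => mul_nonneg (by positivity) (hD0 k)) (Finset.mem_range.2 hk)
        calc D k = 2 ^ k * D k * (1 / 2) ^ k := by
              rw [mul_right_comm, ← mul_pow]; norm_num
          _ ≤ _ := by
              refine mul_le_mul_of_nonneg_right ?_ (by positivity)
              linarith
      · have h1 := (hE k).const_smul (hψ k).1.1 (c k)
        rw [hc, div_mul_cancel₀ _ (hB k).ne'] at h1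
        intro α x
        have hle : (1 / (k + 1 : ℝ)) ≤ ℓ := by
          refine le_trans ?_ hN.le
          exact one_div_le_one_div_of_le (by positivity) (by exact_mod_cast Nat.succ_le_succ hk)
        calc _ ≤ (1 / 2) ^ k * ((1 / (k + 1 : ℝ)) ^ mOrd α * M (mOrd α)) := h1 α x
          _ ≤ (1 / 2) ^ k * (ℓ ^ mOrd α * M (mOrd α)) := by
              have := hM1.1 (mOrd α)
              gcongr
          _ ≤ _ := by
              refine mul_le_mul_of_nonneg_right ?_
                (mul_nonneg (pow_nonneg hℓ.le _) (hM1.1 _).le)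
              exact le_mul_of_one_le_left (by positivity) (by linarith)
  obtain ⟨k, hk⟩ := exists_nat_gt C
  have h1 := hC (h k) (hh k) k
  have h2 : (fun x => (c k • ψ k) (x - h k)) = c k • fun x => ψ k (x - h k) := rfl
  rw [h2, map_smul, norm_smul, hc] at h1
  have h3 := mul_lt_mul_of_pos_left (hlt k) (show 0 < (1 / 2 : ℝ) ^ k / B k by
    have := hB k
    positivity)
  have h4 : (1 / 2 : ℝ) ^ k / B k * ((k + 1) * 2 ^ k * B k * ω (h k)) = (k + 1) * ω (h k) := by
    have := (hB k).ne'
    field_simp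
    rw [← mul_pow]
    norm_num
  rw [h4] at h3
  have h5 := lt_of_mul_lt_mul_right (h3.trans_le h1) (hω _ (hh k)).le
  linarith

end UniformBound

/-! ### Ultradistributions and convolutions -/

section Jets

variable {M : ℕ → ℝ}

/-- The weighted jets of a test function as a bounded family. -/
def jetLp (hM1 : IsM1 M) {ℓ : ℝ} (hℓ : 0 < ℓ) :
    testSpace (d := d) hM1 Set.univ →ₗ[ℂ] lp (fun _ : (Fin d → ℕ) × Rd d => ℂ) ⊤ where
  toFun φ := ⟨fun q => mderiv q.1 (φ : Rd d → ℂ) q.2 / ((ℓ ^ mOrd q.1 * M (mOrd q.1) : ℝ) : ℂ), by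
    obtain ⟨B, hB⟩ := ((isTestD_iff hM1).1 φ.2.1).2.2 ℓ hℓ
    refine memℓp_infty ⟨B, ?_⟩
    rintro _ ⟨q, rfl⟩
    have h := mul_pos (pow_pos hℓ (mOrd q.1)) (hM1.1 (mOrd q.1))
    dsimp only
    rw [norm_div, Complex.norm_real, Real.norm_of_nonneg h.le, div_le_iff₀ h]
    exact hB q.1 q.2⟩
  map_add' φ ψ := by
    ext q
    simp only [Submodule.coe_add, mderiv_fun_add φ.2.1.1 ψ.2.1.1, Pi.add_apply, add_div]
    rfl
  map_smul' c φ := by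
    ext q
    simp [mderiv_const_smul φ.2.1.1, mul_div_assoc]

lemma jetLp_apply (hM1 : IsM1 M) {ℓ : ℝ} (hℓ : 0 < ℓ) (φ : testSpace (d := d) hM1 Set.univ)
    (q : (Fin d → ℕ) × Rd d) : jetLp hM1 hℓ φ q =
      mderiv q.1 (φ : Rd d → ℂ) q.2 / ((ℓ ^ mOrd q.1 * M (mOrd q.1) : ℝ) : ℂ) := rfl

lemma norm_jetLp_le (hM1 : IsM1 M) {ℓ B : ℝ} (hℓ : 0 < ℓ) {φ : testSpace (d := d) hM1 Set.univ}
    (h : EBound M ℓ B (φ : Rd d → ℂ)) : ‖jetLp hM1 hℓ φ‖ ≤ B := by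
  refine lp.norm_le_of_forall_le (h.nonneg hM1) fun q => ?_
  have h0 := mul_pos (pow_pos hℓ (mOrd q.1)) (hM1.1 (mOrd q.1))
  rw [jetLp_apply, norm_div, Complex.norm_real, Real.norm_of_nonneg h0.le, div_le_iff₀ h0]
  exact h q.1 q.2

lemma eBound_jetLp (hM1 : IsM1 M) {ℓ : ℝ} (hℓ : 0 < ℓ) (φ : testSpace (d := d) hM1 Set.univ) :
    EBound M ℓ ‖jetLp hM1 hℓ φ‖ (φ : Rd d → ℂ) := fun α x => by
  have h0 := mul_pos (pow_pos hℓ (mOrd α)) (hM1.1 (mOrd α))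
  have h := lp.norm_apply_le_norm (by simp) (jetLp hM1 hℓ φ) (α, x)
  rwa [jetLp_apply, norm_div, Complex.norm_real, Real.norm_of_nonneg h0.le, div_le_iff₀ h0] at h

lemma mem_testSpace_univ {hM1 : IsM1 M} {φ : Rd d → ℂ} (hφ : IsTestD M φ) :
    φ ∈ testSpace hM1 Set.univ := ⟨hφ, Set.subset_univ _⟩

/-- An ultradistribution is locally given by a continuous functional on bounded jets. -/
lemma IsUltraD.exists_jet_functional (hM1 : IsM1 M) {f : (Rd d → ℂ) →ₗ[ℂ] ℂ} (hf : IsUltraD M f)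
    {K : Set (Rd d)} (hK : IsCompact K) :
    ∃ (ℓ : ℝ) (hℓ : 0 < ℓ) (G : lp (fun _ : (Fin d → ℕ) × Rd d => ℂ) ⊤ →L[ℂ] ℂ),
      ∀ φ : testSpace (d := d) hM1 Set.univ, tsupport (φ : Rd d → ℂ) ⊆ K →
        G (jetLp hM1 hℓ φ) = f φ := by
  obtain ⟨ℓ, hℓ, C, hC, hfC⟩ := hf.exists_bound hM1 hK
  let T : testSpace (d := d) hM1 K →ₗ[ℂ] lp (fun _ : (Fin d → ℕ) × Rd d => ℂ) ⊤ :=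
    jetLp hM1 hℓ ∘ₗ Submodule.inclusion fun φ hφ => mem_testSpace_univ hφ.1
  have hT : Function.Injective T := by
    rw [← LinearMap.ker_eq_bot, LinearMap.ker_eq_bot']
    intro φ hφ
    ext x
    have h : T φ (0, x) = 0 := by rw [hφ]; rfl
    change mderiv 0 (φ : Rd d → ℂ) x / ((ℓ ^ mOrd (0 : Fin d → ℕ) * M (mOrd 0) : ℝ) : ℂ) = 0 at h
    have h0 := mul_pos (pow_pos hℓ (mOrd (0 : Fin d → ℕ))) (hM1.1 (mOrd (0 : Fin d → ℕ)))
    rw [div_eq_zero_iff, or_iff_left (Complex.ofReal_ne_zero.2 h0.ne'), mderiv_zero] at h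
    exact h
  let e := LinearEquiv.ofInjective T hT
  let g : LinearMap.range T →ₗ[ℂ] ℂ := f ∘ₗ (testSpace hM1 K).subtype ∘ₗ e.symm.toLinearMap
  have hg : ∀ v, ‖g v‖ ≤ C * ‖v‖ := by
    intro v
    obtain ⟨φ, rfl⟩ := e.surjective v
    have h1 : g (e φ) = f φ := by simp [g]
    have h2 : ‖e φ‖ = ‖T φ‖ := by rw [Submodule.coe_norm, LinearEquiv.ofInjective_apply]
    rw [h1, h2]
    exact hfC _ _ φ.2.1 φ.2.2 (eBound_jetLp hM1 hℓ _)
  obtain ⟨G, hG, -⟩ := exists_extension_norm_eq _ (g.mkContinuous C hg)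
  refine ⟨ℓ, hℓ, G, fun φ hφ => ?_⟩
  have h := hG (e ⟨φ, φ.2.1, hφ⟩)
  rw [LinearEquiv.ofInjective_apply, LinearMap.mkContinuous_apply] at h
  have h1 : g (e ⟨φ, φ.2.1, hφ⟩) = f φ := by simp [g]
  rw [h1] at h
  exact h

/-- The jets of the translates of a test function. -/
def jetTranslate (hM1 : IsM1 M) {ℓ : ℝ} (hℓ : 0 < ℓ) {ψ : Rd d → ℂ} (hψ : IsTestD M ψ) (y : Rd d) :
    lp (fun _ : (Fin d → ℕ) × Rd d => ℂ) ⊤ :=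
  jetLp hM1 hℓ ⟨fun x => ψ (x - y), mem_testSpace_univ (hψ.translate hM1 y)⟩

lemma continuous_jetTranslate (hM1 : IsM1 M) (hM2 : IsM2 M) {ℓ : ℝ} (hℓ : 0 < ℓ) {ψ : Rd d → ℂ}
    (hψ : IsTestD M ψ) : Continuous (jetTranslate hM1 hℓ hψ) := by
  choose B hB using fun i : Fin d =>
    ((isTestD_iff hM1).1 (hψ.mderiv hM1 hM2 (Pi.single i 1))).2.2 ℓ hℓ
  have hB0 : ∀ i, 0 ≤ B i := fun i => (hB i).nonneg hM1
  have hS : 0 ≤ ∑ i, B i := Finset.sum_nonneg fun i _ => hB0 i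
  refine LipschitzWith.continuous (K := ⟨d * ∑ i, B i, by positivity⟩)
    (LipschitzWith.of_dist_le_mul fun y y' => ?_)
  rw [dist_eq_norm, dist_eq_norm, jetTranslate, jetTranslate, ← map_sub]
  refine norm_jetLp_le hM1 hℓ fun α x => ?_
  change ‖mderiv α ((fun x => ψ (x - y)) - fun x => ψ (x - y')) x‖ ≤ d * (∑ i, B i) * ‖y - y'‖ * _
  rw [mderiv_sub (contDiff_translate hψ.1 y) (contDiff_translate hψ.1 y'), Pi.sub_apply,
    mderiv_translate hψ.1, mderiv_translate hψ.1]
  refine (norm_sub_le_of_norm_pder_le (contDiff_mderiv hψ.1 α)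
    (B := (∑ i, B i) * (ℓ ^ mOrd α * M (mOrd α))) (fun i z => ?_) _ _).trans (le_of_eq ?_)
  · have h1 : pder i (mderiv α ψ) = mderiv α (mderiv (Pi.single i 1) ψ) := by
      rw [← mderiv_add hψ.1, mderiv_add_single hψ.1]
    rw [h1]
    refine (hB i α z).trans (mul_le_mul_of_nonneg_right
      (Finset.single_le_sum (fun i _ => hB0 i) (Finset.mem_univ i))
      (mul_nonneg (pow_nonneg hℓ.le _) (hM1.1 _).le))
  · rw [sub_sub_sub_cancel_left, norm_sub_rev]
    ring

lemma IsUltraD.continuous_translate (hM1 : IsM1 M) (hM2 : IsM2 M) {f : (Rd d → ℂ) →ₗ[ℂ] ℂ}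
    (hf : IsUltraD M f) {ψ : Rd d → ℂ} (hψ : IsTestD M ψ) :
    Continuous fun y => f fun x => ψ (x - y) := by
  rw [continuous_iff_continuousAt]
  intro y₀
  have hK := hψ.2.1.isCompact.add (isCompact_closedBall y₀ 1)
  obtain ⟨ℓ, hℓ, G, hG⟩ := hf.exists_jet_functional hM1 hK
  have h := (G.continuous.comp (continuous_jetTranslate hM1 hM2 hℓ hψ)).continuousAt (x := y₀)
  refine h.congr ?_
  filter_upwards [Metric.closedBall_mem_nhds y₀ one_pos] with y hy
  exact hG ⟨_, mem_testSpace_univ (hψ.translate hM1 y)⟩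
    (testSpace_translate (hM1 := hM1) ⟨hψ, subset_rfl⟩ hy).2

lemma IsUltraD.apply_cv (hM1 : IsM1 M) (hM2 : IsM2 M) {f : (Rd d → ℂ) →ₗ[ℂ] ℂ}
    (hf : IsUltraD M f) {φ ψ : Rd d → ℂ} (hφ : Continuous φ) (hφc : HasCompactSupport φ)
    (hψ : IsTestD M ψ) : f (cv φ ψ) = ∫ y, φ y * f fun x => ψ (x - y) := by
  have hK := hψ.2.1.isCompact.add hφc.isCompact
  obtain ⟨ℓ, hℓ, G, hG⟩ := hf.exists_jet_functional hM1 hK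
  have hc : Continuous fun y => φ y • jetTranslate hM1 hℓ hψ y :=
    hφ.smul (continuous_jetTranslate hM1 hM2 hℓ hψ)
  have hi : Integrable fun y => φ y • jetTranslate hM1 hℓ hψ y :=
    hc.integrable_of_hasCompactSupport hφc.smul_right
  have hcv : IsTestD M (cv φ ψ) := hψ.cv hM1 hφ hφc
  have h1 : jetLp hM1 hℓ ⟨cv φ ψ, mem_testSpace_univ hcv⟩ =
      ∫ y, φ y • jetTranslate hM1 hℓ hψ y := by
    ext q
    have h := (lp.evalCLM ℂ (fun _ : (Fin d → ℕ) × Rd d => ℂ) ⊤ q).integral_comp_comm hi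
    refine Eq.trans ?_ h
    rw [jetLp_apply]
    dsimp only
    rw [(cv_jet hφ hψ.1 hψ.2.1).2, cv, ← integral_div]
    refine integral_congr_ae (Filter.Eventually.of_forall fun y => ?_)
    change _ = φ y * (mderiv q.1 (fun x => ψ (x - y)) q.2 / _)
    rw [mderiv_translate hψ.1]
    exact mul_div_assoc _ _ _
  rw [← hG ⟨cv φ ψ, mem_testSpace_univ hcv⟩ (tsupport_cv_subset hφc hψ.2.1), h1,
    ← G.integral_comp_comm hi]
  refine integral_congr_ae (Filter.Eventually.of_forall fun y => ?_)
  dsimp only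
  rw [map_smul, smul_eq_mul]
  by_cases hy : y ∈ tsupport φ
  · congr 1
    exact hG ⟨_, mem_testSpace_univ (hψ.translate hM1 y)⟩
      (testSpace_translate (hM1 := hM1) ⟨hψ, subset_rfl⟩ hy).2
  · rw [image_eq_zero_of_notMem_tsupport hy, zero_mul, zero_mul]

end Jets

/-! ### Structural representations -/

section Representation

variable {M : ℕ → ℝ} {W : Set (Rd d)} {ω : Rd d → ℝ} {R L : ℝ} {T : Type*}
  {τ : T → Fin d → ℕ} {A : T → Rd d → ℂ} {v : T → ℝ}

/-- The sum of the members of a family whose label is the given multi-index. -/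
def fiberSum (τ : T → Fin d → ℕ) (A : T → Rd d → ℂ) (α : Fin d → ℕ) (y : Rd d) : ℂ :=
  open Classical in ∑' t, if τ t = α then A t y else 0

lemma exists_mem_of_mem_add_ball {y : Rd d} (hy : y ∈ W + Metric.ball 0 R) :
    ∃ x ∈ W, y ∈ Metric.ball x R := by
  obtain ⟨x, hx, h, hh, rfl⟩ := hy
  exact ⟨x, hx, by simpa using hh⟩

lemma isOpen_add_ball : IsOpen (W + Metric.ball (0 : Rd d) R) := Metric.isOpen_ball.add_left

lemma norm_le_of_mem_ball
    (hA : ∀ t, ∀ x ∈ W, ∀ h : Rd d, ‖h‖ < R →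
      ‖A t (x + h)‖ ≤ v t * (L ^ mOrd (τ t) / M (mOrd (τ t))) * ω x)
    (t : T) {x : Rd d} (hx : x ∈ W) {y : Rd d} (hy : y ∈ Metric.ball x R) :
    ‖A t y‖ ≤ v t * (L ^ mOrd (τ t) / M (mOrd (τ t))) * ω x := by
  have := hA t x hx (y - x) (by simpa [dist_eq_norm] using hy)
  rwa [add_sub_cancel] at this

lemma norm_fiber_le (hM1 : IsM1 M) (hω : ∀ x ∈ W, 0 < ω x) (hL : 0 < L) (hv0 : ∀ t, 0 ≤ v t)
    (hA : ∀ t, ∀ x ∈ W, ∀ h : Rd d, ‖h‖ < R →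
      ‖A t (x + h)‖ ≤ v t * (L ^ mOrd (τ t) / M (mOrd (τ t))) * ω x)
    (α : Fin d → ℕ) (t : T) [Decidable (τ t = α)] {x : Rd d}
    (hx : x ∈ W) {y : Rd d} (hy : y ∈ Metric.ball x R) :
    ‖if τ t = α then A t y else 0‖ ≤ v t * ((L ^ mOrd α / M (mOrd α)) * ω x) := by
  split_ifs with h
  · subst h
    rw [← mul_assoc]
    exact norm_le_of_mem_ball hA t hx hy
  · rw [norm_zero]
    have := hM1.1 (mOrd α)
    have := hω x hx
    have := hv0 t
    positivity

lemma norm_fiberSum_le (hM1 : IsM1 M) (hω : ∀ x ∈ W, 0 < ω x) (hL : 0 < L) (hv : Summable v)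
    (hv0 : ∀ t, 0 ≤ v t)
    (hA : ∀ t, ∀ x ∈ W, ∀ h : Rd d, ‖h‖ < R →
      ‖A t (x + h)‖ ≤ v t * (L ^ mOrd (τ t) / M (mOrd (τ t))) * ω x)
    (α : Fin d → ℕ) {x : Rd d} (hx : x ∈ W) {y : Rd d} (hy : y ∈ Metric.ball x R) :
    ‖fiberSum τ A α y‖ ≤ (∑' t, v t) * ((L ^ mOrd α / M (mOrd α)) * ω x) := by
  classical
  rw [fiberSum, ← tsum_mul_right]
  refine tsum_of_norm_bounded (hv.mul_right _).hasSum fun t => ?_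
  exact norm_fiber_le hM1 hω hL hv0 hA α t hx hy

lemma continuousOn_fiberSum (hM1 : IsM1 M) (hω : ∀ x ∈ W, 0 < ω x) (hL : 0 < L) (hv : Summable v)
    (hv0 : ∀ t, 0 ≤ v t) (hAc : ∀ t, Continuous (A t))
    (hA : ∀ t, ∀ x ∈ W, ∀ h : Rd d, ‖h‖ < R →
      ‖A t (x + h)‖ ≤ v t * (L ^ mOrd (τ t) / M (mOrd (τ t))) * ω x)
    (α : Fin d → ℕ) : ContinuousOn (fiberSum τ A α) (W + Metric.ball 0 R) := by
  classical
  intro y hy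
  obtain ⟨x, hx, hyx⟩ := exists_mem_of_mem_add_ball hy
  refine ContinuousAt.continuousWithinAt ?_
  refine ContinuousOn.continuousAt (s := Metric.ball x R) ?_ (Metric.isOpen_ball.mem_nhds hyx)
  unfold fiberSum
  refine continuousOn_tsum (u := fun t => v t * ((L ^ mOrd α / M (mOrd α)) * ω x)) (fun t => ?_)
    (hv.mul_right _) fun t z hz => ?_
  · split_ifs
    · exact (hAc t).continuousOn
    · exact continuousOn_const
  · exact norm_fiber_le hM1 hω hL hv0 hA α t hx hz

/-- A positive function on `W` gives a bound on compact subsets of a neighbourhood of `W`. -/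
lemma exists_weight_bound {K : Set (Rd d)} (hK : IsCompact K) (hKW : K ⊆ W + Metric.ball 0 R)
    (ω : Rd d → ℝ) : ∃ Ω, 0 ≤ Ω ∧ ∀ y ∈ K, ∃ x ∈ W, y ∈ Metric.ball x R ∧ ω x ≤ Ω := by
  obtain ⟨s, hs⟩ := hK.elim_finite_subcover (fun x : W => Metric.ball (x : Rd d) R)
    (fun _ => Metric.isOpen_ball) fun y hy => by
      obtain ⟨x, hx, hyx⟩ := exists_mem_of_mem_add_ball (hKW hy)
      exact Set.mem_iUnion.2 ⟨⟨x, hx⟩, hyx⟩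
  refine ⟨∑ x ∈ s, |ω x|, Finset.sum_nonneg fun _ _ => abs_nonneg _, fun y hy => ?_⟩
  obtain ⟨x, hxs, hyx⟩ := Set.mem_iUnion₂.1 (hs hy)
  exact ⟨x, x.2, hyx, (le_abs_self _).trans
    (Finset.single_le_sum (f := fun x : W => |ω x|) (fun _ _ => abs_nonneg _) hxs)⟩

lemma exists_integral_norm_bound (hM1 : IsM1 M) (hL : 0 < L) (hv0 : ∀ t, 0 ≤ v t)
    (hA : ∀ t, ∀ x ∈ W, ∀ h : Rd d, ‖h‖ < R →
      ‖A t (x + h)‖ ≤ v t * (L ^ mOrd (τ t) / M (mOrd (τ t))) * ω x)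
    {φ : Rd d → ℂ} (hφ : IsTestD M φ) (hφW : tsupport φ ⊆ W + Metric.ball 0 R) :
    ∃ D, 0 ≤ D ∧ ∀ t, ∫ y, ‖mderiv (τ t) φ y * A t y‖ ≤ D * v t := by
  obtain ⟨Ω, hΩ, h⟩ := exists_weight_bound hφ.2.1.isCompact hφW ω
  obtain ⟨B, hB⟩ := ((isTestD_iff hM1).1 hφ).2.2 L⁻¹ (inv_pos.2 hL)
  have hB0 := hB.nonneg hM1
  refine ⟨B * Ω * volume.real (tsupport φ), by positivity, fun t => ?_⟩
  have hpt : ∀ y ∈ tsupport φ, ‖mderiv (τ t) φ y * A t y‖ ≤ B * Ω * v t := by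
    intro y hy
    obtain ⟨x, hx, hyx, hxΩ⟩ := h y hy
    have hM := hM1.1 (mOrd (τ t))
    rw [norm_mul]
    calc _ ≤ B * (L⁻¹ ^ mOrd (τ t) * M (mOrd (τ t))) *
          (v t * (L ^ mOrd (τ t) / M (mOrd (τ t))) * Ω) := by
          refine mul_le_mul (hB _ _) ((norm_le_of_mem_ball hA t hx hyx).trans ?_)
            (norm_nonneg _) (by positivity)
          have := hv0 t
          exact mul_le_mul_of_nonneg_left hxΩ (by positivity)
      _ = B * Ω * v t := by
          rw [inv_pow]
          field_simp
  have h0 : ∀ y ∉ tsupport φ, ‖mderiv (τ t) φ y * A t y‖ = 0 := fun y hy => by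
    rw [image_eq_zero_of_notMem_tsupport fun h => hy (tsupport_mderiv_subset hφ.1 _ h), zero_mul,
      norm_zero]
  rw [← setIntegral_eq_integral_of_forall_compl_eq_zero h0]
  have h1 := norm_setIntegral_le_of_norm_le_const (μ := volume)
    (f := fun y => ‖mderiv (τ t) φ y * A t y‖) (C := B * Ω * v t)
    hφ.2.1.isCompact.measure_lt_top fun y hy => by
      rw [norm_norm]
      exact hpt y hy
  refine (le_abs_self _).trans (h1.trans (le_of_eq ?_))
  ring

lemma hasSum_setIntegral_fiberSum [Countable T] (hM1 : IsM1 M) (hL : 0 < L)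
    (hv : Summable v) (hv0 : ∀ t, 0 ≤ v t) (hAc : ∀ t, Continuous (A t))
    (hA : ∀ t, ∀ x ∈ W, ∀ h : Rd d, ‖h‖ < R →
      ‖A t (x + h)‖ ≤ v t * (L ^ mOrd (τ t) / M (mOrd (τ t))) * ω x)
    {φ : Rd d → ℂ} (hφ : IsTestD M φ) (hφW : tsupport φ ⊆ W + Metric.ball 0 R)
    (α : Fin d → ℕ) [∀ t, Decidable (τ t = α)] :
    HasSum (fun t => if τ t = α then ∫ y, mderiv (τ t) φ y * A t y else 0)
      (∫ y in W + Metric.ball 0 R, fiberSum τ A α y * mderiv α φ y) := by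
  obtain ⟨D, hD0, hD⟩ := exists_integral_norm_bound hM1 hL hv0 hA hφ hφW
  have h := hasSum_integral_of_summable_integral_norm (μ := volume)
    (F := fun t y => if τ t = α then mderiv (τ t) φ y * A t y else 0) (fun t => by
      split_ifs
      · exact ((contDiff_mderiv hφ.1 _).continuous.mul (hAc t)).integrable_of_hasCompactSupport
          (hasCompactSupport_mderiv hφ.1 hφ.2.1 _).mul_right
      · exact integrable_zero _ _ _)
    (Summable.of_nonneg_of_le (fun t => integral_nonneg fun _ => norm_nonneg _) (fun t => by
      split_ifs
      · exact hD t
      · simpa using mul_nonneg hD0 (hv0 t)) (hv.mul_left D))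
  convert! h using 1
  · funext t
    split_ifs <;> simp
  · rw [setIntegral_eq_integral_of_forall_compl_eq_zero fun y hy => ?_]
    · refine integral_congr_ae (Filter.Eventually.of_forall fun y => ?_)
      simp only [fiberSum]
      rw [← tsum_mul_right]
      refine tsum_congr fun t => ?_
      split_ifs with ht
      · rw [ht, mul_comm]
      · rw [zero_mul]
    · rw [image_eq_zero_of_notMem_tsupport
        fun h => hy (hφW (tsupport_mderiv_subset hφ.1 _ h)), mul_zero]

/-- Grouping the terms of an expansion according to the order of differentiation. -/
lemma exists_representation [Countable T] (hM1 : IsM1 M) (hω : ∀ x ∈ W, 0 < ω x) (hL : 0 < L)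
    (hv : Summable v) (hv0 : ∀ t, 0 ≤ v t) (hAc : ∀ t, Continuous (A t))
    (hA : ∀ t, ∀ x ∈ W, ∀ h : Rd d, ‖h‖ < R →
      ‖A t (x + h)‖ ≤ v t * (L ^ mOrd (τ t) / M (mOrd (τ t))) * ω x)
    {f : (Rd d → ℂ) →ₗ[ℂ] ℂ}
    (hf : ∀ φ : Rd d → ℂ, IsTestD M φ → tsupport φ ⊆ W + Metric.ball 0 R →
      HasSum (fun t => ∫ y, mderiv (τ t) φ y * A t y) (f φ)) :
    ∃ F : (Fin d → ℕ) → Rd d → ℂ,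
      (∀ α, ContinuousOn (F α) (W + Metric.ball 0 R)) ∧
      ∃ ℓ > (0 : ℝ), ∃ C > (0 : ℝ),
        (∀ (α : Fin d → ℕ), ∀ x ∈ W, ∀ h : Rd d, ‖h‖ < R →
          ‖F α (x + h)‖ ≤ C * (ℓ ^ mOrd α / M (mOrd α)) * ω x) ∧
        ∀ φ : Rd d → ℂ, IsTestD M φ → tsupport φ ⊆ W + Metric.ball 0 R →
          (∀ α : Fin d → ℕ,
            IntegrableOn (fun x => F α x * mderiv α φ x) (W + Metric.ball 0 R)) ∧
          Summable (fun α : Fin d → ℕ =>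
            ‖∫ x in W + Metric.ball 0 R, F α x * mderiv α φ x‖) ∧
          f φ = ∑' α : Fin d → ℕ,
            (-1 : ℂ) ^ mOrd α * ∫ x in W + Metric.ball 0 R, F α x * mderiv α φ x := by
  classical
  have hcont : ∀ α, ContinuousOn (fun y => (-1 : ℂ) ^ mOrd α * fiberSum τ A α y)
      (W + Metric.ball 0 R) := fun α =>
    continuousOn_const.mul (continuousOn_fiberSum hM1 hω hL hv hv0 hAc hA α)
  have hV : 0 ≤ ∑' t, v t := tsum_nonneg hv0
  refine ⟨fun α y => (-1 : ℂ) ^ mOrd α * fiberSum τ A α y, hcont, L, hL, (∑' t, v t) + 1,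
    by linarith, fun α x hx h hh => ?_, fun φ hφ hφW => ⟨fun α => ?_, ?_⟩⟩
  · have hM := hM1.1 (mOrd α)
    have hwx := hω x hx
    have h1 := norm_fiberSum_le hM1 hω hL hv hv0 hA α hx (y := x + h) (by simpa using hh)
    rw [norm_mul, norm_pow, norm_neg, norm_one, one_pow, one_mul, mul_assoc]
    refine h1.trans (mul_le_mul_of_nonneg_right (by linarith) (by positivity))
  · refine IntegrableOn.of_forall_sdiff_eq_zero (s := tsupport φ) ?_
      isOpen_add_ball.measurableSet fun y hy => ?_
    · exact (((hcont α).mono hφW).mul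
        (contDiff_mderiv hφ.1 α).continuous.continuousOn).integrableOn_compact hφ.2.1.isCompact
    · rw [image_eq_zero_of_notMem_tsupport
        fun h => hy.2 (tsupport_mderiv_subset hφ.1 _ h), mul_zero]
  · have hg : HasSum (fun q : (Fin d → ℕ) × T =>
        if τ q.2 = q.1 then ∫ y, mderiv (τ q.2) φ y * A q.2 y else 0) (f φ) := by
      have hinj : Function.Injective fun t : T => (τ t, t) := fun t t' h => (Prod.ext_iff.1 h).2
      rw [← hinj.hasSum_iff fun q hq => ?_]
      · simpa [Function.comp_def] using hf φ hφ hφW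
      · rw [if_neg]
        rintro h
        exact hq ⟨q.2, Prod.ext h rfl⟩
    have hs := hg.prod_fiberwise fun α =>
      hasSum_setIntegral_fiberSum hM1 hL hv hv0 hAc hA hφ hφW α
    have he : ∀ α : Fin d → ℕ, (-1 : ℂ) ^ mOrd α * ∫ x in W + Metric.ball 0 R,
        (-1 : ℂ) ^ mOrd α * fiberSum τ A α x * mderiv α φ x =
        ∫ y in W + Metric.ball 0 R, fiberSum τ A α y * mderiv α φ y := by
      intro α
      simp only [mul_assoc]
      rw [integral_const_mul, ← mul_assoc, ← mul_pow]
      norm_num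
    refine ⟨?_, ?_⟩
    · refine hs.summable.norm.congr fun α => ?_
      rw [← he α, norm_mul, norm_pow, norm_neg, norm_one, one_pow, one_mul]
    · simp only [he]
      exact hs.tsum_eq.symm

end Representation

/-! ### From boundedness of translates to representations -/

section Expansion

variable {M : ℕ → ℝ} {χ : ℝ → ℂ} {f : (Rd d → ℂ) →ₗ[ℂ] ℂ}

/-- The coefficient functions obtained from the Fourier expansion by `p n` integrations by parts in
the direction `i n`. -/
def coeffFn (χ : ℝ → ℂ) (f : (Rd d → ℂ) →ₗ[ℂ] ℂ) (i : (Fin d → ℤ) → Fin d)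
    (p : (Fin d → ℤ) → ℕ) (t : (Fin d → ℤ) × ℕ) (y : Rd d) : ℂ :=
  (((2 * π * Complex.I * t.1 (i t.1) : ℂ) ^ p t.1)⁻¹ * ((-1) ^ t.2 * ((p t.1).choose t.2 : ℂ))) *
    f fun x => bumpFn χ t.1 (Pi.single (i t.1) t.2) (x - y)

lemma hasSum_coeffFn (hM1 : IsM1 M) (hM2 : IsM2 M) (hM3 : IsM3' M)
    (hχ : ContDiff ℝ (⊤ : ℕ∞) χ) (h0 : ∀ x, 3 / 8 ≤ |x| → χ x = 0)
    (hb : ∀ h > 0, ∃ C > 0, ∀ k x, ‖iteratedDeriv k χ x‖ ≤ C * (h ^ k * M k))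
    (hf : IsUltraD M f) {i : (Fin d → ℤ) → Fin d} {p : (Fin d → ℤ) → ℕ}
    (hp : ∀ n, n (i n) ≠ 0 ∨ p n = 0) {φ : Rd d → ℂ} (hφ : IsTestD M φ) (n : Fin d → ℤ) :
    HasSum (fun m => ∫ y, mderiv (Pi.single (i n) (p n - m)) φ y * coeffFn χ f i p (n, m) y)
      (f (cv φ (bumpFn χ n 0))) := by
  set c : ℂ := 2 * π * Complex.I * n (i n) with hc
  have hc0 : c ^ p n ≠ 0 := by
    rcases hp n with h | h
    · refine pow_ne_zero _ ?_
      simp [hc, h, Real.pi_ne_zero]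
    · simp [h]
  have hterm : ∀ m, ∫ y, mderiv (Pi.single (i n) (p n - m)) φ y * coeffFn χ f i p (n, m) y =
      (c ^ p n)⁻¹ * ((-1) ^ m * ((p n).choose m : ℂ)) *
        f (cv (mderiv (Pi.single (i n) (p n - m)) φ) (bumpFn χ n (Pi.single (i n) m))) := by
    intro m
    rw [hf.apply_cv hM1 hM2 (contDiff_mderiv hφ.1 _).continuous
      (hasCompactSupport_mderiv hφ.1 hφ.2.1 _) (isTestD_bumpFn hM1 hM2 hM3 hχ h0 hb _ _),
      ← integral_const_mul]
    refine integral_congr_ae (Filter.Eventually.of_forall fun y => ?_)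
    simp only [coeffFn, ← hc]
    ring
  have hsum : f (cv φ (bumpFn χ n 0)) = ∑ m ∈ Finset.range (p n + 1),
      ∫ y, mderiv (Pi.single (i n) (p n - m)) φ y * coeffFn χ f i p (n, m) y := by
    have h := congrArg f (cv_bumpFn_expansion hχ h0 hφ.1 hφ.2.1 n (i n) (p n))
    rw [← hc, map_smul, map_sum, smul_eq_mul] at h
    rw [← mul_right_inj' hc0, h, Finset.mul_sum]
    refine Finset.sum_congr rfl fun m _ => ?_
    rw [hterm, map_smul, smul_eq_mul]
    field_simp
  rw [hsum]
  refine hasSum_sum_of_ne_finset_zero fun m hm => ?_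
  rw [hterm, Nat.choose_eq_zero_of_lt (by simpa [Nat.lt_succ_iff] using hm)]
  simp

/-- The arithmetic behind the bound for the coefficient functions. -/
lemma coeff_bound (hM1 : IsM1 M) {p m : ℕ} (hmp : m ≤ p) {P D L C a : ℝ} (hL : 0 < L)
    (hC : 0 < C) (ha : 0 < a) (hPD : P / D ^ p ≤ C * a * (L ^ p / M p)) :
    (D ^ p)⁻¹ * (p.choose m : ℝ) * (((4 * L)⁻¹ ^ m * M m) * P) ≤
      C * M 0 * a * (1 / 2) ^ m * ((2 * L) ^ (p - m) / M (p - m)) := by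
  obtain ⟨q, rfl⟩ := Nat.exists_eq_add_of_le hmp
  rw [Nat.add_sub_cancel_left]
  have hMm := hM1.1 m
  have hMq := hM1.1 q
  have hMp := hM1.1 (m + q)
  have hM0 := hM1.1 0
  have h1 : ((m + q).choose m : ℝ) ≤ 2 ^ (m + q) := by
    exact_mod_cast Nat.choose_le_two_pow _ _
  have h2 : M m / M (m + q) ≤ M 0 / M q := by
    rw [div_le_div_iff₀ hMp hMq]
    exact hM1.mul_le m q
  calc _ = (P / D ^ (m + q)) * ((m + q).choose m : ℝ) * ((4 * L)⁻¹ ^ m * M m) := by ring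
    _ ≤ (C * a * (L ^ (m + q) / M (m + q))) * 2 ^ (m + q) * ((4 * L)⁻¹ ^ m * M m) := by gcongr
    _ = C * a * (2 * L) ^ (m + q) * (4 * L)⁻¹ ^ m * (M m / M (m + q)) := by
        rw [mul_pow]
        ring
    _ ≤ C * a * (2 * L) ^ (m + q) * (4 * L)⁻¹ ^ m * (M 0 / M q) := by gcongr
    _ = C * M 0 * a * ((2 * L) * (4 * L)⁻¹) ^ m * ((2 * L) ^ q / M q) := by
        rw [mul_pow (2 * L) (4 * L)⁻¹, pow_add]
        generalize 2 * L = u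
        ring
    _ = _ := by
        congr 3
        field_simp
        norm_num

lemma norm_coeffFn_le (hM1 : IsM1 M) {i : (Fin d → ℤ) → Fin d} {p : (Fin d → ℤ) → ℕ}
    {n : Fin d → ℤ} {m : ℕ} {y : Rd d} {P L C a C' C₁ w : ℝ} (hL : 0 < L)
    (hC : 0 < C) (ha : 0 < a) (hC' : 0 < C') (hC₁ : 0 < C₁) (hw : 0 < w)
    (hPD : P / (2 * π * |(n (i n) : ℝ)|) ^ p n ≤ C * a * (L ^ p n / M (p n)))
    (hf : ‖f fun x => bumpFn χ n (Pi.single (i n) m) (x - y)‖ ≤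
      C' * (C₁ * ((4 * L)⁻¹ ^ m * M m) * P) * w) :
    ‖coeffFn χ f i p (n, m) y‖ ≤ C' * C₁ * w *
      (C * M 0 * a * (1 / 2) ^ m * ((2 * L) ^ (p n - m) / M (p n - m))) := by
  have hM0 := hM1.1 0
  have hMq := hM1.1 (p n - m)
  rcases le_or_gt m (p n) with hmp | hmp
  · have hcb := coeff_bound hM1 hmp hL hC ha hPD
    have hz : ‖((2 * π * Complex.I * n (i n) : ℂ) ^ p n)⁻¹ *
        ((-1) ^ m * ((p n).choose m : ℂ))‖ =
        ((2 * π * |(n (i n) : ℝ)|) ^ p n)⁻¹ * ((p n).choose m : ℝ) := by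
      simp only [norm_mul, norm_inv, norm_pow, norm_neg, norm_one, one_pow, one_mul, mul_one,
        Complex.norm_natCast, Complex.norm_I, Complex.norm_intCast, Complex.norm_real,
        Complex.norm_ofNat, Real.norm_of_nonneg pi_nonneg]
    rw [coeffFn, norm_mul, hz]
    calc _ ≤ _ := mul_le_mul_of_nonneg_left hf (by positivity)
      _ = C' * C₁ * w * (((2 * π * |(n (i n) : ℝ)|) ^ p n)⁻¹ * ((p n).choose m : ℝ) *
          (((4 * L)⁻¹ ^ m * M m) * P)) := by ring
      _ ≤ _ := mul_le_mul_of_nonneg_left hcb (by positivity)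
  · have : coeffFn χ f i p (n, m) y = 0 := by
      simp [coeffFn, Nat.choose_eq_zero_of_lt hmp]
    rw [this, norm_zero]
    positivity

/-- A functional whose translates by elements of `W` are bounded relative to `ω` has the structural
representation. -/
lemma exists_representation_of_bounded [Nonempty (Fin d)] (hM1 : IsM1 M) (hM2 : IsM2 M)
    (hM3 : IsM3' M) {W : Set (Rd d)} {ω : Rd d → ℝ} (hω : ∀ x ∈ W, 0 < ω x) (hf : IsUltraD M f)
    (hfb : ∀ φ : Rd d → ℂ, IsTestD M φ →
      ∃ C : ℝ, ∀ h ∈ W, ‖f (fun x => φ (x - h))‖ ≤ C * ω h) (R : ℝ) :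
    ∃ F : (Fin d → ℕ) → Rd d → ℂ,
      (∀ α, ContinuousOn (F α) (W + Metric.ball 0 R)) ∧
      ∃ ℓ > (0 : ℝ), ∃ C > (0 : ℝ),
        (∀ (α : Fin d → ℕ), ∀ x ∈ W, ∀ h : Rd d, ‖h‖ < R →
          ‖F α (x + h)‖ ≤ C * (ℓ ^ mOrd α / M (mOrd α)) * ω x) ∧
        ∀ φ : Rd d → ℂ, IsTestD M φ → tsupport φ ⊆ W + Metric.ball 0 R →
          (∀ α : Fin d → ℕ,
            IntegrableOn (fun x => F α x * mderiv α φ x) (W + Metric.ball 0 R)) ∧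
          Summable (fun α : Fin d → ℕ =>
            ‖∫ x in W + Metric.ball 0 R, F α x * mderiv α φ x‖) ∧
          f φ = ∑' α : Fin d → ℕ,
            (-1 : ℂ) ^ mOrd α * ∫ x in W + Metric.ball 0 R, F α x * mderiv α φ x := by
  obtain ⟨χ, hχ, h1, h0, hb⟩ := exists_bump_one_dim hM1 hM3
  obtain ⟨ℓ, hℓ, C, hC, hfC⟩ := exists_uniform_translation_bound hM1 hf hω hfb
    ((isCompact_closedBall (0 : Rd d) d).add (isCompact_closedBall (0 : Rd d) R))
  obtain ⟨E, -, hE, L, hL, C₃, hC₃, hn⟩ :=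
    exists_frequency_order (d := d) hM1 hM2 hM3 (half_pos hℓ)
  choose i p hp hip using hn
  obtain ⟨C₁, hC₁, hbump⟩ := eBound_bumpFn (d := d) hM1 hM2 hχ hb (half_pos hℓ)
    (inv_pos.2 (mul_pos four_pos hL))
  rw [mul_div_cancel₀ ℓ two_ne_zero] at hbump
  have hM0 := hM1.1 0
  have hK : 0 < C * C₁ * (C₃ * M 0) := by positivity
  set v : (Fin d → ℤ) × ℕ → ℝ := fun t => C * C₁ * (C₃ * M 0) * (latW t.1 * (1 / 2) ^ t.2) with hv
  have hv0 : ∀ t, 0 ≤ v t := fun t => by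
    have := latW_pos t.1
    positivity
  have hvs : Summable v := by
    refine Summable.mul_left _ (Summable.mul_of_nonneg summable_latW summable_geometric_two
      (fun n => (latW_pos n).le) fun m => ?_)
    positivity
  let τ : (Fin d → ℤ) × ℕ → Fin d → ℕ := fun t => Pi.single (i t.1) (p t.1 - t.2)
  have hAc : ∀ t, Continuous (coeffFn χ f i p t) := fun t =>
    continuous_const.mul (hf.continuous_translate hM1 hM2
      (isTestD_bumpFn hM1 hM2 hM3 hχ h0 hb _ _))
  have hA : ∀ t, ∀ x ∈ W, ∀ h : Rd d, ‖h‖ < R → ‖coeffFn χ f i p t (x + h)‖ ≤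
      v t * ((2 * L) ^ mOrd (τ t) / M (mOrd (τ t))) * ω x := by
    rintro ⟨n, m⟩ x hx h hh
    rw [show mOrd (τ (n, m)) = p n - m from mOrd_single _ _]
    have hf1 : ∀ κ, ‖f fun z => bumpFn χ n κ (z - (x + h))‖ ≤
        C * (C₁ * ((4 * L)⁻¹ ^ mOrd κ * M (mOrd κ)) * ∏ j, E (n j)) * ω x := fun κ => by
      have ht := isTestD_bumpFn hM1 hM2 hM3 hχ h0 hb n κ
      have := hfC x hx _ _ (testSpace_translate (hM1 := hM1)
        ⟨ht, tsupport_bumpFn_subset h0 n κ⟩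
        (mem_closedBall_zero_iff.2 hh.le)) ((hbump E hE n κ).translate ht.1 h)
      simpa only [sub_sub] using this
    refine (norm_coeffFn_le hM1 hL hC₃ (latW_pos n) hC hC₁
      (hω x hx) (hip n) (by simpa using hf1 (Pi.single (i n) m))).trans (le_of_eq ?_)
    simp only [hv]
    ring
  refine exists_representation (L := 2 * L) (τ := τ) (A := coeffFn χ f i p) (v := v) hM1 hω
    (mul_pos two_pos hL) hvs hv0 hAc hA fun φ hφ hφW => ?_
  obtain ⟨D, -, hD⟩ := exists_integral_norm_bound
    (L := 2 * L) (τ := τ) (A := coeffFn χ f i p) (v := v) hM1 (mul_pos two_pos hL) hv0 hA hφ hφW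
  have hs : Summable fun t : (Fin d → ℤ) × ℕ =>
      ∫ y, mderiv (τ t) φ y * coeffFn χ f i p t y :=
    Summable.of_norm_bounded (hvs.mul_left D) fun t =>
      (norm_integral_le_integral_norm _).trans (hD t)
  have h2 := hs.hasSum.prod_fiberwise fun n => hasSum_coeffFn hM1 hM2 hM3 hχ h0 hb hf hp hφ n
  rw [(hasSum_apply_cv_bumpFn hM1 hM2 hM3 hχ h1 h0 hb hf hφ).unique h2]
  exact hs.hasSum

end Expansion

/-! ### From representations to boundedness of translates -/

section Translates

variable {M : ℕ → ℝ} {W : Set (Rd d)} {R : ℝ}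

lemma summable_half_pow_mOrd : Summable fun α : Fin d → ℕ => (1 / 2 : ℝ) ^ mOrd α := by
  have := summable_pi_prod (d := d) (f := fun k : ℕ => (1 / 2 : ℝ) ^ k)
    (fun k => by positivity) summable_geometric_two
  simpa only [mOrd, Finset.prod_pow_eq_pow_sum] using this

lemma norm_setIntegral_translate_le {F : Rd d → ℂ} {φ : Rd d → ℂ}
    (hφ : ContDiff ℝ (⊤ : ℕ∞) φ) (hφR : tsupport φ ⊆ Metric.ball 0 R) {α : Fin d → ℕ} {B C : ℝ}
    (hC : 0 ≤ C) (hB : ∀ x, ‖mderiv α φ x‖ ≤ B) {h : Rd d} (hh : h ∈ W)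
    (hF : ∀ y : Rd d, ‖y‖ < R → ‖F (h + y)‖ ≤ C) :
    ‖∫ x in W + Metric.ball 0 R, F x * mderiv α (fun x => φ (x - h)) x‖ ≤
      C * B * volume.real (Metric.ball (0 : Rd d) R) := by
  have hsub : Metric.ball h R ⊆ W + Metric.ball 0 R := fun x hx =>
    ⟨h, hh, x - h, by simpa [dist_eq_norm] using hx, add_sub_cancel _ _⟩
  rw [mderiv_translate hφ, setIntegral_eq_of_subset_of_forall_sdiff_eq_zero
    isOpen_add_ball.measurableSet hsub fun x hx => ?_]
  · rw [← Measure.addHaar_real_ball_center volume h R]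
    refine norm_setIntegral_le_of_norm_le_const measure_ball_lt_top fun x hx => ?_
    have := hF (x - h) (by simpa [dist_eq_norm] using hx)
    rw [add_sub_cancel] at this
    rw [norm_mul]
    exact mul_le_mul this (hB _) (norm_nonneg _) hC
  · beta_reduce
    rw [image_eq_zero_of_notMem_tsupport (f := mderiv α φ) fun h' => hx.2 ?_, mul_zero]
    simpa [dist_eq_norm] using hφR (tsupport_mderiv_subset hφ _ h')

lemma bounded_of_representation (hM1 : IsM1 M) {ω : Rd d → ℝ} (hω : ∀ x ∈ W, 0 < ω x)
    {f : (Rd d → ℂ) →ₗ[ℂ] ℂ} {φ : Rd d → ℂ} (hφ : IsTestD M φ)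
    (hφR : tsupport φ ⊆ Metric.ball 0 R) {F : (Fin d → ℕ) → Rd d → ℂ} {ℓ C : ℝ} (hℓ : 0 < ℓ)
    (hC : 0 < C)
    (hF : ∀ (α : Fin d → ℕ), ∀ x ∈ W, ∀ h : Rd d, ‖h‖ < R →
      ‖F α (x + h)‖ ≤ C * (ℓ ^ mOrd α / M (mOrd α)) * ω x)
    (hf : ∀ φ : Rd d → ℂ, IsTestD M φ → tsupport φ ⊆ W + Metric.ball 0 R →
      f φ = ∑' α : Fin d → ℕ,
        (-1 : ℂ) ^ mOrd α * ∫ x in W + Metric.ball 0 R, F α x * mderiv α φ x) :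
    ∃ C : ℝ, ∀ h ∈ W, ‖f (fun x => φ (x - h))‖ ≤ C * ω h := by
  obtain ⟨B, hB⟩ := ((isTestD_iff hM1).1 hφ).2.2 (2 * ℓ)⁻¹ (by positivity)
  refine ⟨C * B * volume.real (Metric.ball (0 : Rd d) R) *
    ∑' α : Fin d → ℕ, (1 / 2 : ℝ) ^ mOrd α, fun h hh => ?_⟩
  have hωh := hω h hh
  rw [hf _ (hφ.translate hM1 h) ?_, mul_right_comm, ← tsum_mul_left]
  · refine tsum_of_norm_bounded (summable_half_pow_mOrd.mul_left _).hasSum fun α => ?_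
    have hMα := hM1.1 (mOrd α)
    rw [norm_mul, norm_pow, norm_neg, norm_one, one_pow, one_mul]
    refine (norm_setIntegral_translate_le hφ.1 hφR (by positivity) (hB α) hh
      (hF α h hh)).trans (le_of_eq ?_)
    rw [mul_inv, mul_pow, inv_pow ℓ, one_div]
    field_simp
  · rw [tsupport_translate]
    exact fun x hx => ⟨h, hh, x - h, hφR hx, add_sub_cancel _ _⟩

end Translates

/-- structural characterization of S-asymptotic boundedness on an
unbounded set `W` for an arbitrary positive weight `ω` on `W`, under `(M.1)`,
`(M.2)` and `(M.3)`. -/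
theorem stmt10 {d : ℕ} (M : ℕ → ℝ) (hM1 : IsM1 M) (hM2 : IsM2 M) (hM3 : IsM3 M)
    (W : Set (Rd d)) (hW : ¬ Bornology.IsBounded W)
    (ω : Rd d → ℝ) (hωpos : ∀ x ∈ W, 0 < ω x)
    (f : (Rd d → ℂ) →ₗ[ℂ] ℂ) (hf : IsUltraD M f) :
    (∀ φ : Rd d → ℂ, IsTestD M φ →
        ∃ C : ℝ, ∀ h ∈ W, ‖f (fun x => φ (x - h))‖ ≤ C * ω h) ↔
      (∀ R > (0 : ℝ), ∃ F : (Fin d → ℕ) → Rd d → ℂ,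
        (∀ α, ContinuousOn (F α) (W + Metric.ball 0 R)) ∧
        ∃ ℓ > (0 : ℝ), ∃ C > (0 : ℝ),
          (∀ (α : Fin d → ℕ), ∀ x ∈ W, ∀ h : Rd d, ‖h‖ < R →
            ‖F α (x + h)‖ ≤ C * (ℓ ^ mOrd α / M (mOrd α)) * ω x) ∧
          ∀ φ : Rd d → ℂ, IsTestD M φ → tsupport φ ⊆ W + Metric.ball 0 R →
            (∀ α : Fin d → ℕ,
              IntegrableOn (fun x => F α x * mderiv α φ x) (W + Metric.ball 0 R)) ∧
            Summable (fun α : Fin d → ℕ =>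
              ‖∫ x in W + Metric.ball 0 R, F α x * mderiv α φ x‖) ∧
            f φ = ∑' α : Fin d → ℕ,
              (-1 : ℂ) ^ mOrd α * ∫ x in W + Metric.ball 0 R, F α x * mderiv α φ x) := by
  constructor
  · intro h R _
    have : Nonempty (Fin d) := by
      by_contra hd
      rw [not_nonempty_iff] at hd
      exact hW (Set.toFinite W).isBounded
    exact exists_representation_of_bounded hM1 hM2 hM3.1 hωpos hf h R
  · intro h φ hφ
    obtain ⟨R, hR, hφR⟩ := hφ.2.1.isCompact.isBounded.subset_ball_lt 0 0
    obtain ⟨F, -, ℓ, hℓ, C, hC, hF, hrep⟩ := h R hR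
    exact bounded_of_representation hM1 hωpos hφ hφR hℓ hC hF
      fun ψ hψ hψW => (hrep ψ hψ hψW).2.2
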